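/- Fix θ = (σ,δ,α) with σ > 0, δ > 0, α ∈ (0,2), set Γ_n = √((1−α/2) ln n) and K(θ) = ∂_α c_α + c_α ln(δ/σ). There exist C > 0 and N ∈ ℕ such that for all n ≥ N: (i) | ∫_ℝ (h_α²/f_α)(y, w_n(θ)) dy − w_n(θ)^{2α} α² c_α² ∫_{|y|>Γ_n} (ψ_α^{(0)}(y))² / (φ(y) + c_α w_n(θ)^α ψ_α^{(0)}(y)) dy | ≤ C (1/(ln n)^{1/4}) · 1/(n^{1−α/2} (ln n)^{α/2}); (ii) | ∫_ℝ (h_α l_α/f_α)(y, w_n(θ)) dy − w_n(θ)^{2α} [ α c_α² ∫_{|y|>Γ_n} ψ_α^{(1)}(y) ψ_α^{(0)}(y)/(φ(y) + c_α w_n(θ)^α ψ_α^{(0)}(y)) dy − α c_α ((c_α/2) ln(ln n) + K(θ)) ∫_{|y|>Γ_n} (ψ_α^{(0)}(y))²/(φ(y) + c_α w_n(θ)^α ψ_α^{(0)}(y)) dy ] | ≤ C (ln(ln n)/(ln n)^{1/4}) · 1/(n^{1−α/2} (ln n)^{α/2}); (iii) | ∫_ℝ (l_α²/f_α)(y, w_n(θ))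 dy − w_n(θ)^{2α} [ c_α² ∫_{|y|>Γ_n} (ψ_α^{(1)}(y))²/(φ(y) + c_α w_n(θ)^α ψ_α^{(0)}(y)) dy − 2 c_α ((c_α/2) ln(ln n) + K(θ)) ∫_{|y|>Γ_n} ψ_α^{(1)}(y) ψ_α^{(0)}(y)/(φ(y) + c_α w_n(θ)^α ψ_α^{(0)}(y)) dy + ((c_α/2) ln(ln n) + K(θ))² ∫_{|y|>Γ_n} (ψ_α^{(0)}(y))²/(φ(y) + c_α w_n(θ)^α ψ_α^{(0)}(y)) dy ] | ≤ C ((ln(ln n))²/(ln n)^{1/4}) · 1/(n^{1−α/2} (ln n)^{α/2}). -/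

import Mathlib

open MeasureTheory Filter Set Topology Matrix

noncomputable section

namespace LevyLAN

/-- Standard Gaussian density `φ`. -/
def gauss (y : ℝ) : ℝ := (Real.sqrt (2 * Real.pi))⁻¹ * Real.exp (-(y ^ 2) / 2)

/-- Symmetric `α`-stable density `φ_α`, defined by Fourier inversion. -/
def stableDensity (α z : ℝ) : ℝ :=
  (2 * Real.pi)⁻¹ * ∫ u : ℝ, Real.cos (z * u) * Real.exp (-(|u| ^ α))

/-- `∂_α φ_α`. -/
def stableDensityDalpha (α z : ℝ) : ℝ :=
  -(2 * Real.pi)⁻¹ * ∫ u : ℝ, Real.cos (z * u) * |u| ^ α * Real.log |u| * Real.exp (-(|u| ^ α))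

/-- The operator `(D f) y = (y * f y)' = f y + y * f' y`. -/
def Dop (f : ℝ → ℝ) (y : ℝ) : ℝ := f y + y * deriv f y

/-- `f_α(y, w)`. -/
def fFun (α y w : ℝ) : ℝ := ∫ z : ℝ, gauss (y - w * z) * stableDensity α z

/-- `g_α(y, w)`. -/
def gFun (α y w : ℝ) : ℝ := ∫ z : ℝ, Dop gauss (y - w * z) * stableDensity α z

/-- `h_α(y, w)`. -/
def hFun (α y w : ℝ) : ℝ := ∫ z : ℝ, gauss (y - w * z) * Dop (stableDensity α) z

/-- `k_α(y, w)`. -/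
def kFun (α y w : ℝ) : ℝ := ∫ z : ℝ, gauss (y - w * z) * stableDensityDalpha α z

/-- `c_α`. -/
def cAlpha (α : ℝ) : ℝ :=
  if α = 1 then 1 / Real.pi
  else -(α * (α - 1)) / (2 * Real.Gamma (2 - α) * Real.cos (Real.pi * α / 2))

/-- `w_n(θ) = n^{1/2 - 1/α} δ / σ`. -/
def wn (n : ℕ) (σ δ α : ℝ) : ℝ := (n : ℝ) ^ ((1 : ℝ) / 2 - 1 / α) * δ / σ

/-- `l_α(y, w)` (it depends on `n`). -/
def lFun (n : ℕ) (α y w : ℝ) : ℝ :=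
  ((Real.log n - Real.log (Real.log n)) / (2 * α) - Real.log n / α ^ 2) * hFun α y w
    + kFun α y w

def kappa0 (σ δ α : ℝ) : ℝ := 2 * cAlpha α / (α * (2 - α) ^ (α / 2)) * (δ / σ) ^ α

def kappa1 (σ δ α : ℝ) : ℝ :=
  Real.log (δ / σ) + deriv cAlpha α / cAlpha α - Real.log (2 - α) / 2 - 1 / α

/-- The density `p_{1/n}(y, θ)`, with parameter `θ = (σ, δ, α) : Fin 3 → ℝ`. -/
def pdens (n : ℕ) (θ : Fin 3 → ℝ) (y : ℝ) : ℝ :=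
  Real.sqrt n / θ 0 * fFun (θ 2) (Real.sqrt n * y / θ 0) (wn n (θ 0) (θ 1) (θ 2))

/-- The log-likelihood `ln L_n(θ)`. -/
def logLik (n : ℕ) (θ : Fin 3 → ℝ) (x : Fin n → ℝ) : ℝ :=
  ∑ i, Real.log (pdens n θ (x i))

/-- Partial derivative in the `j`-th parameter coordinate. -/
def pderiv (j : Fin 3) (F : (Fin 3 → ℝ) → ℝ) (θ : Fin 3 → ℝ) : ℝ :=
  deriv (fun t => F (Function.update θ j t)) (θ j)

/-- The score `G_n(θ) = ∇_θ ln L_n(θ)`. -/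
def scoreVec (n : ℕ) (θ : Fin 3 → ℝ) (x : Fin n → ℝ) : Fin 3 → ℝ :=
  fun j => pderiv j (fun θ' => logLik n θ' x) θ

/-- The Hessian matrix `J_n(θ)` of the log-likelihood. -/
def hessMat (n : ℕ) (θ : Fin 3 → ℝ) (x : Fin n → ℝ) : Matrix (Fin 3) (Fin 3) ℝ :=
  Matrix.of fun i j => pderiv i (fun θ' => pderiv j (fun θ'' => logLik n θ'' x) θ') θ

def rate (n : ℕ) (α : ℝ) : ℝ := Real.log n ^ (α / 4) / (n : ℝ) ^ (α / 4)

/-- The rate matrix `u_n(θ)`. -/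
def un (n : ℕ) (θ : Fin 3 → ℝ) : Matrix (Fin 3) (Fin 3) ℝ :=
  !![1 / Real.sqrt n, 0, 0;
     0, rate n (θ 2), -(rate n (θ 2) * (θ 1 / (2 * θ 2)) * (Real.log n - Real.log (Real.log n)));
     0, 0, rate n (θ 2)]

/-- The information matrix `I(θ)`. -/
def Imat (θ : Fin 3 → ℝ) : Matrix (Fin 3) (Fin 3) ℝ :=
  !![2 / θ 0 ^ 2, 0, 0;
     0, θ 2 ^ 2 / θ 1 ^ 2 * kappa0 (θ 0) (θ 1) (θ 2),
        θ 2 / θ 1 * kappa0 (θ 0) (θ 1) (θ 2) * kappa1 (θ 0) (θ 1) (θ 2);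
     0, θ 2 / θ 1 * kappa0 (θ 0) (θ 1) (θ 2) * kappa1 (θ 0) (θ 1) (θ 2),
        kappa0 (θ 0) (θ 1) (θ 2) * (kappa1 (θ 0) (θ 1) (θ 2) ^ 2 + 1 / θ 2 ^ 2)]

/-- `ℙ_n`, the `n`-fold product of the law with Lebesgue density `p_{1/n}(·, θ)`. -/
def Pn (n : ℕ) (θ : Fin 3 → ℝ) : Measure (Fin n → ℝ) :=
  Measure.pi fun _ => MeasureTheory.volume.withDensity fun y => ENNReal.ofReal (pdens n θ y)

/-- The standard Gaussian measure on `ℝ³`. -/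
def stdGauss3 : Measure (Fin 3 → ℝ) :=
  Measure.pi fun _ => ProbabilityTheory.gaussianReal 0 1

/-- Euclidean (Frobenius) norm of a real 3×3 matrix. -/
def frobNorm (M : Matrix (Fin 3) (Fin 3) ℝ) : ℝ := Real.sqrt (∑ i, ∑ j, M i j ^ 2)

/-- Euclidean norm of a vector of `ℝ³`. -/
def vecNorm (v : Fin 3 → ℝ) : ℝ := Real.sqrt (∑ j, v j ^ 2)

/-- The admissible families of functions `ψ_α^{(p)}`. -/
structure IsPsiFamily (ψ : ℝ → ℕ → ℝ → ℝ) : Prop where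
  contDiff : ∀ α ∈ Set.Ioo (0 : ℝ) 2, ∀ p : ℕ, ContDiff ℝ 2 (ψ α p)
  pos : ∀ α ∈ Set.Ioo (0 : ℝ) 2, ∀ p : ℕ, ∀ y : ℝ, 0 < ψ α p y
  even : ∀ α ∈ Set.Ioo (0 : ℝ) 2, ∀ p : ℕ, ∀ y : ℝ, ψ α p (-y) = ψ α p y
  eq_one : ∀ α ∈ Set.Ioo (0 : ℝ) 2, ∀ p : ℕ, ∀ y : ℝ, |y| ≤ 1 → ψ α p y = 1
  eq_tail : ∀ α ∈ Set.Ioo (0 : ℝ) 2, ∀ p : ℕ, ∀ y : ℝ, 3 ≤ |y| →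
    ψ α p y = Real.log |y| ^ p / |y| ^ (α + 1)
  unifBound : ∀ K : Set ℝ, K ⊆ Set.Ioo (0 : ℝ) 2 → IsCompact K → ∀ p : ℕ,
    ∃ c > (0 : ℝ), ∃ C : ℝ, ∀ α ∈ K, ∀ y : ℝ, 1 ≤ |y| → |y| ≤ 3 →
      c ≤ ψ α p y ∧ ψ α p y ≤ C

/-- `𝓘_α^{(k,l)}`. -/
def Ical (ψ : ℝ → ℕ → ℝ → ℝ) (α : ℝ) (k l : ℕ) (y : ℝ) : ℝ :=
  ∫ z in {z : ℝ | 1 < |z|}, Dop^[k] gauss (y - z) * ψ α l z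

/-- `f_α^{(k,l,m)}`. -/
def fklm (α : ℝ) (k l m : ℕ) (y w : ℝ) : ℝ :=
  ∫ z : ℝ, Dop^[k] gauss (y - w * z)
    * Dop^[l] (fun z' => iteratedDeriv m (fun a => stableDensity a z') α) z

def Gamman (n : ℕ) (α : ℝ) : ℝ := Real.sqrt ((1 - α / 2) * Real.log n)

def Mn (n : ℕ) (α : ℝ) : ℝ := Real.sqrt ((2 - α) * Real.log n)

def Kconst (σ δ α : ℝ) : ℝ := deriv cAlpha α + cAlpha α * Real.log (δ / σ)



/-- Families of functions with Euler-type derivative bounds. -/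
def EC : ℕ → (ℝ → ℝ) → (ℝ → ℝ → ℝ) → Prop
  | 0, m, F => (∃ A, 0 ≤ A ∧ ∀ v ∈ Ioc (0:ℝ) 1, ∀ u, 0 < u → |F v u| ≤ A * m u) ∧
      ∀ v ∈ Ioc (0:ℝ) 1, ContinuousOn (F v) (Ioi 0)
  | (k+1), m, F => (∃ A, 0 ≤ A ∧ ∀ v ∈ Ioc (0:ℝ) 1, ∀ u, 0 < u → |F v u| ≤ A * m u) ∧
      ∃ G : ℝ → ℝ → ℝ, (∀ v ∈ Ioc (0:ℝ) 1, ∀ u, 0 < u → HasDerivAt (F v) (G v u / u) u) ∧ EC k m G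

lemma EC.bound {k : ℕ} {m : ℝ → ℝ} {F : ℝ → ℝ → ℝ} (h : EC k m F) :
    ∃ A, 0 ≤ A ∧ ∀ v ∈ Ioc (0:ℝ) 1, ∀ u, 0 < u → |F v u| ≤ A * m u := by
  cases k with
  | zero => exact h.1
  | succ k => exact h.1

lemma EC.cont {k : ℕ} {m : ℝ → ℝ} {F : ℝ → ℝ → ℝ} (h : EC k m F) :
    ∀ v ∈ Ioc (0:ℝ) 1, ContinuousOn (F v) (Ioi 0) := by
  cases k with
  | zero => exact h.2
  | succ k =>
    obtain ⟨_, G, hG, _⟩ := h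
    intro v hv u hu
    exact (hG v hv u hu).continuousAt.continuousWithinAt

lemma EC.down {k : ℕ} : ∀ {m : ℝ → ℝ} {F : ℝ → ℝ → ℝ}, EC (k+1) m F → EC k m F := by
  induction k with
  | zero => intro m F h; exact ⟨h.bound, h.cont⟩
  | succ k ih =>
    intro m F h
    obtain ⟨hb, G, hG, hG'⟩ := h
    exact ⟨hb, G, hG, ih hG'⟩

lemma EC.mono {k : ℕ} : ∀ {m m' : ℝ → ℝ} {F : ℝ → ℝ → ℝ} {B : ℝ}, (∀ u, 0 < u → m u ≤ B * m' u) →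
    0 ≤ B → EC k m F → EC k m' F := by
  have key : ∀ {m m' : ℝ → ℝ} {F : ℝ → ℝ → ℝ} {B : ℝ}, (∀ u, 0 < u → m u ≤ B * m' u) → 0 ≤ B →
      (∃ A, 0 ≤ A ∧ ∀ v ∈ Ioc (0:ℝ) 1, ∀ u, 0 < u → |F v u| ≤ A * m u) →
      (∃ A, 0 ≤ A ∧ ∀ v ∈ Ioc (0:ℝ) 1, ∀ u, 0 < u → |F v u| ≤ A * m' u) := by
    rintro m m' F B h hB ⟨A, hA, hF⟩
    refine ⟨A * B, by positivity, fun v hv u hu => (hF v hv u hu).trans ?_⟩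
    rw [mul_assoc]
    exact mul_le_mul_of_nonneg_left (h u hu) hA
  induction k with
  | zero => intro m m' F B h hB hF; exact ⟨key h hB hF.1, hF.2⟩
  | succ k ih =>
    intro m m' F B h hB hF
    obtain ⟨hb, G, hG, hG'⟩ := hF
    exact ⟨key h hB hb, G, hG, ih h hB hG'⟩

lemma EC.add {k : ℕ} : ∀ {m : ℝ → ℝ} {F G : ℝ → ℝ → ℝ}, EC k m F → EC k m G →
    EC k m (fun v u => F v u + G v u) := by
  have key : ∀ {m : ℝ → ℝ} {F G : ℝ → ℝ → ℝ}, 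
      (∃ A, 0 ≤ A ∧ ∀ v ∈ Ioc (0:ℝ) 1, ∀ u, 0 < u → |F v u| ≤ A * m u) →
      (∃ A, 0 ≤ A ∧ ∀ v ∈ Ioc (0:ℝ) 1, ∀ u, 0 < u → |G v u| ≤ A * m u) →
      (∃ A, 0 ≤ A ∧ ∀ v ∈ Ioc (0:ℝ) 1, ∀ u, 0 < u → |F v u + G v u| ≤ A * m u) := by
    rintro m F G ⟨A, hA, hF⟩ ⟨B, hB, hG⟩
    refine ⟨A + B, by positivity, fun v hv u hu => (abs_add_le _ _).trans ?_⟩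
    rw [add_mul]
    exact add_le_add (hF v hv u hu) (hG v hv u hu)
  induction k with
  | zero => intro m F G hF hG; exact ⟨key hF.1 hG.1, fun v hv => (hF.2 v hv).add (hG.2 v hv)⟩
  | succ k ih =>
    intro m F G hF hG
    obtain ⟨hb, F', hF', hF''⟩ := hF
    obtain ⟨hc, G', hG', hG''⟩ := hG
    refine ⟨key hb hc, fun v u => F' v u + G' v u, fun v hv u hu => ?_, ih hF'' hG''⟩
    have := (hF' v hv u hu).add (hG' v hv u hu)
    rw [← add_div] at this
    exact this

lemma EC.mul {k : ℕ} : ∀ {m m' : ℝ → ℝ} {F G : ℝ → ℝ → ℝ}, EC k m F → EC k m' G →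
    EC k (fun u => m u * m' u) (fun v u => F v u * G v u) := by
  have key : ∀ {m m' : ℝ → ℝ} {F G : ℝ → ℝ → ℝ}, 
      (∃ A, 0 ≤ A ∧ ∀ v ∈ Ioc (0:ℝ) 1, ∀ u, 0 < u → |F v u| ≤ A * m u) →
      (∃ A, 0 ≤ A ∧ ∀ v ∈ Ioc (0:ℝ) 1, ∀ u, 0 < u → |G v u| ≤ A * m' u) →
      (∃ A, 0 ≤ A ∧ ∀ v ∈ Ioc (0:ℝ) 1, ∀ u, 0 < u → |F v u * G v u| ≤ A * (m u * m' u)) := by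
    rintro m m' F G ⟨A, hA, hF⟩ ⟨B, hB, hG⟩
    refine ⟨A * B, by positivity, fun v hv u hu => ?_⟩
    rw [abs_mul]
    calc |F v u| * |G v u| ≤ (A * m u) * (B * m' u) :=
          mul_le_mul (hF v hv u hu) (hG v hv u hu) (abs_nonneg _)
            ((abs_nonneg _).trans (hF v hv u hu))
      _ = _ := by ring
  induction k with
  | zero => intro m m' F G hF hG; exact ⟨key hF.1 hG.1, fun v hv => (hF.2 v hv).mul (hG.2 v hv)⟩
  | succ k ih =>
    intro m m' F G hF hG
    have hF0 := hF.down
    have hG0 := hG.down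
    obtain ⟨hb, F', hF', hF''⟩ := hF
    obtain ⟨hc, G', hG', hG''⟩ := hG
    refine ⟨key hb hc, fun v u => F' v u * G v u + F v u * G' v u, fun v hv u hu => ?_,
      (ih hF'' hG0).add (ih hF0 hG'')⟩
    have := (hF' v hv u hu).mul (hG' v hv u hu)
    refine this.congr_deriv ?_
    ring

lemma EC_const (k : ℕ) (c : ℝ) : EC k (fun _ => 1) (fun _ _ => c) := by
  induction k generalizing c with
  | zero => exact ⟨⟨|c|, abs_nonneg _, fun _ _ _ _ => by simp⟩, fun _ _ => continuousOn_const⟩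
  | succ k ih =>
    refine ⟨⟨|c|, abs_nonneg _, fun _ _ _ _ => by simp⟩, fun _ _ => 0, fun v hv u hu => ?_, ih 0⟩
    simpa using hasDerivAt_const u c

lemma EC.const_mul {k : ℕ} {m : ℝ → ℝ} {F : ℝ → ℝ → ℝ} (c : ℝ) (h : EC k m F) :
    EC k m (fun v u => c * F v u) :=
  ((EC_const k c).mul h).mono (B := 1) (fun u _ => by simp) zero_le_one

lemma EC_rpow (k : ℕ) (a : ℝ) : EC k (fun u => u ^ a) (fun _ u => u ^ a) := by
  induction k with
  | zero =>
    refine ⟨⟨1, zero_le_one, fun v hv u hu => ?_⟩, fun v hv => ?_⟩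
    · rw [one_mul, abs_of_pos (Real.rpow_pos_of_pos hu a)]
    · intro u hu
      exact (Real.continuousAt_rpow_const u a (Or.inl (ne_of_gt hu))).continuousWithinAt
  | succ k ih =>
    refine ⟨⟨1, zero_le_one, fun v hv u hu => ?_⟩, fun _ u => a * u ^ a, fun v hv u hu => ?_,
      ih.const_mul a⟩
    · rw [one_mul, abs_of_pos (Real.rpow_pos_of_pos hu a)]
    · have := Real.hasDerivAt_rpow_const (p := a) (Or.inl (ne_of_gt hu))
      rw [Real.rpow_sub_one (ne_of_gt hu), ← mul_div_assoc] at this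
      exact this

lemma EC_log (k : ℕ) : EC k (fun u => 1 + |Real.log u|) (fun _ u => Real.log u) := by
  cases k with
  | zero =>
    refine ⟨⟨1, zero_le_one, fun v hv u hu => by linarith⟩, fun v hv => ?_⟩
    intro u hu
    exact (Real.continuousAt_log (ne_of_gt hu)).continuousWithinAt
  | succ k =>
    refine ⟨⟨1, zero_le_one, fun v hv u hu => by linarith⟩, fun _ _ => 1, fun v hv u hu => ?_,
      (EC_const k 1).mono (B := 1) (fun u hu => ?_) zero_le_one⟩
    · simpa using Real.hasDerivAt_log (ne_of_gt hu)
    · have := abs_nonneg (Real.log u)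
      linarith

/-- `u ^ s * exp (-b u)` is bounded. -/
lemma pow_exp_bdd (b : ℝ) (hb : 0 < b) (s : ℕ) :
    ∃ C, 0 ≤ C ∧ ∀ u : ℝ, 0 < u → u ^ s * Real.exp (-(b * u)) ≤ C := by
  refine ⟨s.factorial / b ^ s, by positivity, fun u hu => ?_⟩
  have h := Real.pow_div_factorial_le_exp (b * u) (by positivity) s
  rw [Real.exp_neg, ← div_eq_mul_inv, div_le_div_iff₀ (Real.exp_pos _) (by positivity)]
  rw [div_le_iff₀ (by positivity), mul_pow] at h
  linarith

lemma rpow_exp_bdd (b : ℝ) (hb : 0 < b) (s : ℝ) (hs : 0 ≤ s) :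
    ∃ C, 0 ≤ C ∧ ∀ u : ℝ, 0 < u → u ^ s * Real.exp (-(b * u)) ≤ C := by
  obtain ⟨N, hN⟩ := exists_nat_ge s
  obtain ⟨C, hC, h⟩ := pow_exp_bdd b hb N
  refine ⟨1 + C, by positivity, fun u hu => ?_⟩
  have h1 : u ^ s ≤ 1 + u ^ N := by
    rcases le_total u 1 with h1 | h1
    · have := Real.rpow_le_one hu.le h1 hs
      have : 0 ≤ u ^ N := by positivity
      linarith
    · have : u ^ s ≤ u ^ (N:ℝ) := Real.rpow_le_rpow_of_exponent_le h1 hN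
      rw [Real.rpow_natCast] at this
      linarith
  have h2 : Real.exp (-(b * u)) ≤ 1 := Real.exp_le_one_iff.2 (by have := mul_pos hb hu; linarith)
  calc _ ≤ (1 + u ^ N) * Real.exp (-(b * u)) := mul_le_mul_of_nonneg_right h1 (Real.exp_pos _).le
    _ = Real.exp (-(b * u)) + u ^ N * Real.exp (-(b * u)) := by ring
    _ ≤ _ := add_le_add h2 (h u hu)

lemma log_rpow_exp_bdd (b : ℝ) (hb : 0 < b) (a : ℝ) (ha : 0 < a) :
    ∃ C, 0 ≤ C ∧ ∀ u : ℝ, 0 < u → (1 + |Real.log u|) * (u ^ a * Real.exp (-(b * u))) ≤ C := by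
  obtain ⟨C1, hC1, h1⟩ := rpow_exp_bdd b hb a ha.le
  obtain ⟨C2, hC2, h2⟩ := rpow_exp_bdd b hb (a + a) (by linarith)
  refine ⟨C1 + C2 / a + 1 / a, by positivity, fun u hu => ?_⟩
  have hl : |Real.log u| ≤ u ^ a / a + u ^ (-a) / a := by
    have e1 := Real.log_le_rpow_div hu.le ha
    have e2 := Real.log_le_rpow_div (inv_pos.2 hu).le ha
    rw [Real.log_inv, Real.inv_rpow hu.le, ← Real.rpow_neg hu.le] at e2
    have p1 : 0 ≤ u ^ a / a := by positivity
    have p2 : 0 ≤ u ^ (-a) / a := by positivity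
    rw [abs_le]; constructor <;> linarith
  have hx : Real.exp (-(b * u)) ≤ 1 := Real.exp_le_one_iff.2 (by have := mul_pos hb hu; linarith)
  have e0 : 0 ≤ u ^ a * Real.exp (-(b * u)) := by positivity
  calc _ ≤ (1 + (u ^ a / a + u ^ (-a) / a)) * (u ^ a * Real.exp (-(b * u))) := by gcongr
    _ = u ^ a * Real.exp (-(b * u)) + (u ^ a * u ^ a) * Real.exp (-(b * u)) / a
        + (u ^ (-a) * u ^ a) * Real.exp (-(b * u)) / a := by ring
    _ ≤ C1 + C2 / a + 1 / a := by
        rw [← Real.rpow_add hu, ← Real.rpow_add hu, neg_add_cancel, Real.rpow_zero, one_mul]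
        have := h1 u hu
        have := h2 u hu
        gcongr

lemma EC_exp (k : ℕ) : ∀ j : ℕ, EC k (fun u => Real.exp (-(1/2 * u)))
    (fun _ u => u ^ j * Real.exp (-u)) := by
  have key : ∀ j : ℕ, ∃ A, 0 ≤ A ∧ ∀ v ∈ Ioc (0:ℝ) 1, ∀ u : ℝ, 0 < u →
      |u ^ j * Real.exp (-u)| ≤ A * Real.exp (-(1/2 * u)) := by
    intro j
    obtain ⟨C, hC, h⟩ := pow_exp_bdd (1/2) (by norm_num) j
    refine ⟨C, hC, fun v hv u hu => ?_⟩
    rw [abs_of_nonneg (by positivity)]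
    have : Real.exp (-u) = Real.exp (-(1/2 * u)) * Real.exp (-(1/2 * u)) := by
      rw [← Real.exp_add]; congr 1; ring
    rw [this, ← mul_assoc]
    exact mul_le_mul_of_nonneg_right (h u hu) (Real.exp_pos _).le
  induction k with
  | zero => exact fun j => ⟨key j, fun v hv => by fun_prop⟩
  | succ k ih =>
    intro j
    refine ⟨key j, _, fun v hv u hu => ?_, ((ih j).const_mul j).add ((ih (j+1)).const_mul (-1))⟩
    have h1 := (hasDerivAt_pow j u).mul ((hasDerivAt_neg u).exp)
    refine h1.congr_deriv ?_
    field_simp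
    cases j with
    | zero => simp
    | succ j => simp; ring

lemma EC_expSq (k : ℕ) : ∀ j : ℕ, EC k (fun u => Real.exp (-(1/2 * u)))
    (fun _ u => u ^ j * Real.exp (-(u^2) / 2)) := by
  have key : ∀ j : ℕ, ∃ A, 0 ≤ A ∧ ∀ v ∈ Ioc (0:ℝ) 1, ∀ u : ℝ, 0 < u →
      |u ^ j * Real.exp (-(u^2) / 2)| ≤ A * Real.exp (-(1/2 * u)) := by
    intro j
    obtain ⟨C, hC, h⟩ := pow_exp_bdd (1/2) (by norm_num) j
    refine ⟨C * Real.exp (1/2), by positivity, fun v hv u hu => ?_⟩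
    rw [abs_of_nonneg (by positivity)]
    have : Real.exp (-(u^2)/2) ≤ Real.exp (-(1/2 * u)) * Real.exp (1/2) * Real.exp (-(1/2 * u)) := by
      rw [← Real.exp_add, ← Real.exp_add]
      apply Real.exp_le_exp.2
      nlinarith [sq_nonneg (u - 1)]
    calc _ ≤ u ^ j * (Real.exp (-(1/2 * u)) * Real.exp (1/2) * Real.exp (-(1/2 * u))) := by gcongr
      _ = (u ^ j * Real.exp (-(1/2 * u))) * Real.exp (1/2) * Real.exp (-(1/2 * u)) := by ring
      _ ≤ _ := by have := h u hu; gcongr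
  induction k with
  | zero => exact fun j => ⟨key j, fun v hv => by fun_prop⟩
  | succ k ih =>
    intro j
    refine ⟨key j, _, fun v hv u hu => ?_, ((ih j).const_mul j).add ((ih (j+2)).const_mul (-1))⟩
    have h0 : HasDerivAt (fun u : ℝ => -(u^2)/2) (-u) u := by
      have := ((hasDerivAt_pow 2 u).neg).div_const 2
      refine this.congr_deriv ?_
      simp
      ring
    have h1 := (hasDerivAt_pow j u).mul h0.exp
    refine h1.congr_deriv ?_
    field_simp
    cases j with
    | zero => simp; ring
    | succ j => simp; ring

lemma EC_expv (α : ℝ) (k : ℕ) : ∀ j : ℕ, EC k (fun _ => 1)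
    (fun v u => (v * u ^ α) ^ j * Real.exp (-(v * u ^ α))) := by
  have key : ∀ j : ℕ, ∃ A, 0 ≤ A ∧ ∀ v ∈ Ioc (0:ℝ) 1, ∀ u : ℝ, 0 < u →
      |(v * u ^ α) ^ j * Real.exp (-(v * u ^ α))| ≤ A * 1 := by
    intro j
    obtain ⟨C, hC, h⟩ := pow_exp_bdd 1 (by norm_num) j
    refine ⟨C, by positivity, fun v hv u hu => ?_⟩
    have hp : 0 < v * u ^ α := mul_pos hv.1 (Real.rpow_pos_of_pos hu α)
    rw [abs_of_nonneg (by positivity), mul_one]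
    simpa using h _ hp
  have hder : ∀ v u : ℝ, 0 < u → HasDerivAt (fun u : ℝ => v * u ^ α) (α * (v * u ^ α) / u) u := by
    intro v u hu
    have := (Real.hasDerivAt_rpow_const (p := α) (Or.inl (ne_of_gt hu))).const_mul v
    rw [Real.rpow_sub_one (ne_of_gt hu)] at this
    refine this.congr_deriv ?_
    ring
  induction k with
  | zero =>
    refine fun j => ⟨key j, fun v hv u hu => ContinuousAt.continuousWithinAt ?_⟩
    have := (hder v u hu).continuousAt
    fun_prop
  | succ k ih =>
    intro j
    refine ⟨key j, _, fun v hv u hu => ?_,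
      ((ih j).const_mul (α * j)).add ((ih (j+1)).const_mul (-α))⟩
    have h1 := ((hder v u hu).pow j).mul (hder v u hu).neg.exp
    refine h1.congr_deriv ?_
    cases j with
    | zero => simp; field_simp
    | succ j => simp [-mul_eq_mul_right_iff]; field_simp; ring

/-- `(exp(-v u^α) - 1)/v`. -/
lemma EC_g1 (α : ℝ) (k : ℕ) : EC k (fun u => u ^ α)
    (fun v u => (Real.exp (-(v * u ^ α)) - 1) / v) := by
  have hder : ∀ v ∈ Ioc (0:ℝ) 1, ∀ u : ℝ, 0 < u →
      HasDerivAt (fun u : ℝ => (Real.exp (-(v * u ^ α)) - 1) / v)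
      ((-α * (u ^ α * ((v * u ^ α) ^ 0 * Real.exp (-(v * u ^ α))))) / u) u := by
    intro v hv u hu
    have := (Real.hasDerivAt_rpow_const (p := α) (Or.inl (ne_of_gt hu))).const_mul v
    rw [Real.rpow_sub_one (ne_of_gt hu)] at this
    have h2 := (this.neg.exp.sub_const 1).div_const v
    refine h2.congr_deriv ?_
    have := hv.1.ne'
    field_simp
    simp
    ring
  have key : ∃ A, 0 ≤ A ∧ ∀ v ∈ Ioc (0:ℝ) 1, ∀ u : ℝ, 0 < u →
      |(Real.exp (-(v * u ^ α)) - 1) / v| ≤ A * u ^ α := by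
    refine ⟨1, zero_le_one, fun v hv u hu => ?_⟩
    have hp : 0 < v * u ^ α := mul_pos hv.1 (Real.rpow_pos_of_pos hu α)
    rw [abs_div, abs_of_pos hv.1, div_le_iff₀ hv.1, abs_le]
    have h1 := Real.add_one_le_exp (-(v * u ^ α))
    have h2 : Real.exp (-(v * u ^ α)) ≤ 1 := Real.exp_le_one_iff.2 (by linarith)
    constructor <;> linarith
  have hG : ∀ k, EC k (fun u => u ^ α)
      (fun v u => -α * (u ^ α * ((v * u ^ α) ^ 0 * Real.exp (-(v * u ^ α))))) := fun k =>
    (((EC_rpow k α).mul (EC_expv α k 0)).const_mul (-α)).mono (B := 1) (fun u _ => by simp)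
      zero_le_one
  have : EC (k+1) (fun u => u ^ α) (fun v u => (Real.exp (-(v * u ^ α)) - 1) / v) :=
    ⟨key, _, hder, hG k⟩
  exact this.down

/-- `(1 - exp(-v u^α) - v u^α)/v^2`. -/
lemma EC_g2 (α : ℝ) (k : ℕ) : EC k (fun u => u ^ α * u ^ α)
    (fun v u => (1 - Real.exp (-(v * u ^ α)) - v * u ^ α) / v ^ 2) := by
  have hder : ∀ v ∈ Ioc (0:ℝ) 1, ∀ u : ℝ, 0 < u →
      HasDerivAt (fun u : ℝ => (1 - Real.exp (-(v * u ^ α)) - v * u ^ α) / v ^ 2)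
      ((α * (u ^ α * ((Real.exp (-(v * u ^ α)) - 1) / v))) / u) u := by
    intro v hv u hu
    have := (Real.hasDerivAt_rpow_const (p := α) (Or.inl (ne_of_gt hu))).const_mul v
    rw [Real.rpow_sub_one (ne_of_gt hu)] at this
    have h2 := ((this.neg.exp.const_sub 1).sub this).div_const (v ^ 2)
    refine h2.congr_deriv ?_
    have := hv.1.ne'
    simp only [Pi.neg_apply]
    field_simp
  have key : ∃ A, 0 ≤ A ∧ ∀ v ∈ Ioc (0:ℝ) 1, ∀ u : ℝ, 0 < u →
      |(1 - Real.exp (-(v * u ^ α)) - v * u ^ α) / v ^ 2| ≤ A * (u ^ α * u ^ α) := by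
    refine ⟨1, zero_le_one, fun v hv u hu => ?_⟩
    have hp : 0 < v * u ^ α := mul_pos hv.1 (Real.rpow_pos_of_pos hu α)
    rw [abs_div, abs_of_pos (pow_pos hv.1 2), div_le_iff₀ (pow_pos hv.1 2), abs_le]
    have h1 := Real.add_one_le_exp (-(v * u ^ α))
    have h3 : Real.exp (-(v * u ^ α)) ≤ 1 / (1 + v * u ^ α) := by
      rw [Real.exp_neg, ← one_div]
      apply one_div_le_one_div_of_le (by linarith)
      have := Real.add_one_le_exp (v * u ^ α)
      linarith
    have h4 : 1 / (1 + v * u ^ α) ≤ 1 - v * u ^ α + (v * u ^ α) ^ 2 := by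
      rw [div_le_iff₀ (by linarith)]
      nlinarith [pow_pos hp 3]
    constructor
    · nlinarith
    · nlinarith [sq_nonneg (v * u ^ α)]
  have : EC (k+1) (fun u => u ^ α * u ^ α)
      (fun v u => (1 - Real.exp (-(v * u ^ α)) - v * u ^ α) / v ^ 2) :=
    ⟨key, _, hder, ((EC_rpow k α).mul (EC_g1 α k)).const_mul α⟩
  exact this.down

lemma abs_exp_sub_exp_le (a b : ℝ) :
    |Real.exp (-a) - Real.exp (-b)| ≤ |a - b| * (Real.exp (-a) + Real.exp (-b)) := by
  have h1 := Real.add_one_le_exp (a - b)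
  have h2 := Real.add_one_le_exp (b - a)
  have e1 : Real.exp (a - b) * Real.exp (-a) = Real.exp (-b) := by rw [← Real.exp_add]; congr 1; ring
  have e2 : Real.exp (b - a) * Real.exp (-b) = Real.exp (-a) := by rw [← Real.exp_add]; congr 1; ring
  have p1 := Real.exp_pos (-a)
  have p2 := Real.exp_pos (-b)
  have q1 := mul_le_mul_of_nonneg_right h1 p1.le
  have q2 := mul_le_mul_of_nonneg_right h2 p2.le
  rw [e1] at q1
  rw [e2] at q2
  have r1 := mul_le_mul_of_nonneg_right (le_abs_self (a-b)) p1.le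
  have r2 := mul_le_mul_of_nonneg_right (le_abs_self (a-b)) p2.le
  have r3 := mul_le_mul_of_nonneg_right (neg_abs_le (a-b)) p1.le
  have r4 := mul_le_mul_of_nonneg_right (neg_abs_le (a-b)) p2.le
  have s1 := mul_nonneg (abs_nonneg (a-b)) p1.le
  have s2 := mul_nonneg (abs_nonneg (a-b)) p2.le
  rw [abs_le]
  constructor <;> nlinarith

/-- `exp(-u²/2) - exp(-u)`. -/
lemma EC_d0 (k : ℕ) : EC k (fun u => u ^ (1:ℝ) * Real.exp (-(1/2 * u)))
    (fun _ u => Real.exp (-(u^2)/2) - Real.exp (-u)) := by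
  have key : ∃ A, 0 ≤ A ∧ ∀ v ∈ Ioc (0:ℝ) 1, ∀ u : ℝ, 0 < u →
      |Real.exp (-(u^2)/2) - Real.exp (-u)| ≤ A * (u ^ (1:ℝ) * Real.exp (-(1/2 * u))) := by
    obtain ⟨A0, hA0, h0⟩ := (EC_exp 0 0).bound
    obtain ⟨A1, hA1, h1⟩ := (EC_exp 0 1).bound
    obtain ⟨B0, hB0, k0⟩ := (EC_expSq 0 0).bound
    obtain ⟨B1, hB1, k1⟩ := (EC_expSq 0 1).bound
    refine ⟨A0 + A1 + B0 + B1, by positivity, fun v hv u hu => ?_⟩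
    have a0 := h0 v hv u hu
    have a1 := h1 v hv u hu
    have b0 := k0 v hv u hu
    have b1 := k1 v hv u hu
    rw [abs_of_nonneg (by positivity)] at a0 a1 b0 b1
    have := abs_exp_sub_exp_le (u^2/2) u
    rw [← neg_div] at this
    refine this.trans ?_
    have hab : |u^2/2 - u| ≤ u * (1 + u) := by rw [abs_le]; constructor <;> nlinarith
    calc _ ≤ (u * (1+u)) * (Real.exp (-(u^2)/2) + Real.exp (-u)) := by gcongr
      _ = u * (u ^ 0 * Real.exp (-u) + u ^ 1 * Real.exp (-u) + u ^ 0 * Real.exp (-(u^2)/2)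
            + u ^ 1 * Real.exp (-(u^2)/2)) := by ring
      _ ≤ u * (A0 * Real.exp (-(1/2*u)) + A1 * Real.exp (-(1/2*u)) + B0 * Real.exp (-(1/2*u))
            + B1 * Real.exp (-(1/2*u))) := by gcongr
      _ = _ := by rw [Real.rpow_one]; ring
  have hG := (EC_rpow k 1).mul (((EC_expSq k 1).const_mul (-1)).add (EC_exp k 0))
  have : EC (k+1) (fun u => u ^ (1:ℝ) * Real.exp (-(1/2 * u)))
    (fun _ u => Real.exp (-(u^2)/2) - Real.exp (-u)) := by
    refine ⟨key, _, fun v hv u hu => ?_, hG⟩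
    have h0 : HasDerivAt (fun u : ℝ => -(u^2)/2) (-u) u := by
      have := ((hasDerivAt_pow 2 u).neg).div_const 2
      refine this.congr_deriv ?_
      simp
      ring
    have h1 := h0.exp.sub (hasDerivAt_neg u).exp
    refine h1.congr_deriv ?_
    rw [Real.rpow_one]
    field_simp
    ring
  exact this.down


/-- Weight `u^β exp(-u/4)`. -/
def Wt (β u : ℝ) : ℝ := u ^ β * Real.exp (-(1/4 * u))

lemma Wt_nonneg (β : ℝ) {u : ℝ} (hu : 0 < u) : 0 ≤ Wt β u :=
  mul_nonneg (Real.rpow_nonneg hu.le _) (Real.exp_pos _).le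

lemma Wt_le (β : ℝ) {u : ℝ} (hu : 0 < u) : Wt β u ≤ u ^ β := by
  have : Real.exp (-(1/4 * u)) ≤ 1 := Real.exp_le_one_iff.2 (by linarith)
  exact mul_le_of_le_one_right (Real.rpow_nonneg hu.le _) this

lemma Wt_integrableOn (β : ℝ) {a : ℝ} (ha : 0 < a) : IntegrableOn (Wt β) (Ioi a) := by
  apply integrable_of_isBigO_exp_neg (b := 1/8) (by norm_num)
  · intro u hu
    have hu0 : 0 < u := lt_of_lt_of_le ha hu
    refine ContinuousAt.continuousWithinAt ?_
    exact (Real.continuousAt_rpow_const u β (Or.inl hu0.ne')).mul (by fun_prop)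
  · have h := (isLittleO_rpow_exp_pos_mul_atTop β (b := 1/8) (by norm_num)).isBigO
    have h2 := h.mul (Asymptotics.isBigO_refl (fun u : ℝ => Real.exp (-(1/4*u))) atTop)
    refine h2.congr (fun _ => rfl) (fun u => ?_)
    rw [← Real.exp_add]; congr 1; ring

lemma Wt_integrableOn_zero (β : ℝ) (hβ : -1 < β) : IntegrableOn (Wt β) (Ioi 0) := by
  rw [← Ioc_union_Ioi_eq_Ioi (zero_le_one (α := ℝ))]
  refine IntegrableOn.union ?_ (Wt_integrableOn β one_pos)
  have h0 : IntegrableOn (fun u : ℝ => u ^ β) (Ioc 0 1) := by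
    have := intervalIntegral.intervalIntegrable_rpow' (a := 0) (b := 1) hβ
    rwa [intervalIntegrable_iff_integrableOn_Ioc_of_le zero_le_one] at this
  refine h0.mono' ?_ ?_
  · refine ContinuousOn.aestronglyMeasurable (fun u hu => ContinuousAt.continuousWithinAt ?_)
      measurableSet_Ioc
    exact (Real.continuousAt_rpow_const u β (Or.inl hu.1.ne')).mul (by fun_prop)
  · refine (ae_restrict_mem measurableSet_Ioc).mono (fun u hu => ?_)
    rw [Real.norm_of_nonneg (Wt_nonneg β hu.1)]
    exact Wt_le β hu.1

lemma Wt_tendsto (β : ℝ) : Tendsto (Wt β) atTop (𝓝 0) := by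
  have h := isLittleO_rpow_exp_pos_mul_atTop β (b := 1/4) (by norm_num)
  have := h.tendsto_div_nhds_zero
  refine this.congr (fun u => ?_)
  rw [Wt, Real.exp_neg]; rfl

lemma EC.integrableOn {k : ℕ} {β : ℝ} {F : ℝ → ℝ → ℝ} (h : EC k (Wt β) F) {v : ℝ}
    (hv : v ∈ Ioc (0:ℝ) 1) {a : ℝ} (ha : 0 < a) : IntegrableOn (F v) (Ioi a) := by
  obtain ⟨A, hA, hb⟩ := h.bound
  refine ((Wt_integrableOn β ha).const_mul A).mono' ?_ ?_
  · exact ((h.cont v hv).mono (Ioi_subset_Ioi ha.le)).aestronglyMeasurable measurableSet_Ioi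
  · exact (ae_restrict_mem measurableSet_Ioi).mono (fun u hu => hb v hv u (ha.trans hu))

lemma EC.integrableOn_zero {k : ℕ} {β : ℝ} (hβ : -1 < β) {F : ℝ → ℝ → ℝ} (h : EC k (Wt β) F) {v : ℝ}
    (hv : v ∈ Ioc (0:ℝ) 1) : IntegrableOn (F v) (Ioi 0) := by
  obtain ⟨A, hA, hb⟩ := h.bound
  refine ((Wt_integrableOn_zero β hβ).const_mul A).mono' ?_ ?_
  · exact (h.cont v hv).aestronglyMeasurable measurableSet_Ioi
  · exact (ae_restrict_mem measurableSet_Ioi).mono (fun u hu => hb v hv u hu)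

lemma norm_cexp_mul_I (x : ℝ) : ‖Complex.exp ((x:ℂ) * Complex.I)‖ = 1 :=
  Complex.norm_exp_ofReal_mul_I x

lemma integrableOn_cexp_mul {f : ℝ → ℝ} {s : Set ℝ} (h : IntegrableOn f s) (y : ℝ) :
    IntegrableOn (fun u : ℝ => Complex.exp (((y * u : ℝ) : ℂ) * Complex.I) * (f u : ℂ)) s := by
  refine Integrable.bdd_mul (c := 1) h.ofReal ?_ ?_
  · exact Continuous.aestronglyMeasurable (by fun_prop)
  · exact Eventually.of_forall (fun u => (norm_cexp_mul_I _).le)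

lemma osc_ibp {a y : ℝ} (hy : 0 < y) {F G : ℝ → ℝ}
    (hd : ∀ u ∈ Ici a, HasDerivAt F (G u) u) (hF : IntegrableOn F (Ioi a))
    (hG : IntegrableOn G (Ioi a)) (hF0 : Tendsto F atTop (𝓝 0)) :
    ‖∫ u in Ioi a, Complex.exp (((y * u : ℝ) : ℂ) * Complex.I) * (F u : ℂ)‖ ≤
      (|F a| + ‖∫ u in Ioi a, Complex.exp (((y * u : ℝ) : ℂ) * Complex.I) * (G u : ℂ)‖) / y := by
  have hyI : ((y:ℂ) * Complex.I) ≠ 0 := mul_ne_zero (by exact_mod_cast hy.ne') Complex.I_ne_zero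
  have h1 := integral_Ioi_of_hasDerivAt_of_tendsto' (a := a) (m := (0:ℂ))
    (f := fun u : ℝ => Complex.exp (((y * u : ℝ) : ℂ) * Complex.I) * (F u : ℂ))
    (f' := fun u : ℝ => (y * Complex.I) * (Complex.exp (((y * u : ℝ) : ℂ) * Complex.I) * (F u : ℂ))
      + Complex.exp (((y * u : ℝ) : ℂ) * Complex.I) * (G u : ℂ)) ?_ ?_ ?_
  · rw [integral_add ((integrableOn_cexp_mul hF y).const_mul _) (integrableOn_cexp_mul hG y),
      integral_const_mul] at h1
    have h2 : (y * Complex.I) * (∫ u in Ioi a, Complex.exp (((y * u : ℝ) : ℂ) * Complex.I) * (F u : ℂ))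
       = -(Complex.exp (((y * a : ℝ) : ℂ) * Complex.I) * (F a : ℂ)) -
        ∫ u in Ioi a, Complex.exp (((y * u : ℝ) : ℂ) * Complex.I) * (G u : ℂ) := by
      rw [eq_sub_iff_add_eq, h1]; ring
    have h3 := congrArg norm h2
    rw [norm_mul, norm_mul, Complex.norm_I, mul_one, Complex.norm_real, Real.norm_of_nonneg hy.le] at h3
    rw [le_div_iff₀ hy, mul_comm, h3]
    refine (norm_sub_le _ _).trans ?_
    rw [norm_neg, norm_mul, norm_cexp_mul_I, one_mul, Complex.norm_real, Real.norm_eq_abs]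
  · intro u hu
    have e1 : HasDerivAt (fun u : ℝ => ((y * u : ℝ) : ℂ) * Complex.I) (y * Complex.I) u := by
      have := ((hasDerivAt_id u).const_mul y).ofReal_comp.mul_const Complex.I
      simpa using this
    refine (e1.cexp.mul (hd u hu).ofReal_comp).congr_deriv ?_
    ring
  · exact ((integrableOn_cexp_mul hF y).const_mul _).add (integrableOn_cexp_mul hG y)
  · rw [tendsto_zero_iff_norm_tendsto_zero]
    have : Tendsto (fun u => |F u|) atTop (𝓝 0) := by simpa using hF0.abs
    refine this.congr (fun u => ?_)
    rw [norm_mul, norm_cexp_mul_I, one_mul, Complex.norm_real, Real.norm_eq_abs]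

lemma osc_tail (k : ℕ) : ∀ (γ : ℝ) (F : ℝ → ℝ → ℝ), γ < k - 1 → EC k (Wt γ) F →
    ∃ C, 0 ≤ C ∧ ∀ v ∈ Ioc (0:ℝ) 1, ∀ y : ℝ, 0 < y →
      ‖∫ u in Ioi (1/y), Complex.exp (((y * u : ℝ) : ℂ) * Complex.I) * (F v u : ℂ)‖
        ≤ C * y ^ (-γ-1) := by
  induction k with
  | zero =>
    intro γ F hγ h
    have hγ' : γ < -1 := by simpa using hγ
    obtain ⟨A, hA, hb⟩ := h.bound
    refine ⟨A / (-γ-1), div_nonneg hA (by linarith), fun v hv y hy => ?_⟩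
    have hy' : 0 < 1 / y := by positivity
    have hInteg := (integrableOn_Ioi_rpow_of_lt hγ' hy').const_mul A
    have := norm_integral_le_of_norm_le (f := fun u : ℝ =>
      Complex.exp (((y * u : ℝ) : ℂ) * Complex.I) * (F v u : ℂ)) hInteg
      ((ae_restrict_mem measurableSet_Ioi).mono (fun u hu => ?_))
    · refine this.trans (le_of_eq ?_)
      rw [integral_const_mul, integral_Ioi_rpow_of_lt hγ' hy', one_div, Real.inv_rpow hy.le,
        ← Real.rpow_neg hy.le]
      have e : -γ - 1 = -(γ + 1) := by ring
      rw [e]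
      field_simp
    · have hu0 : 0 < u := hy'.trans hu
      rw [norm_mul, norm_cexp_mul_I, one_mul, Complex.norm_real, Real.norm_eq_abs]
      exact (hb v hv u hu0).trans (mul_le_mul_of_nonneg_left (Wt_le γ hu0) hA)
  | succ k ih =>
    intro γ F hγ h
    have hF := h
    obtain ⟨⟨A, hA, hb⟩, G, hG, hG'⟩ := h
    have hG2 : EC k (Wt (γ-1)) (fun v u => G v u / u) := by
      have e := (hG'.mul (EC_rpow k (-1))).mono (m' := Wt (γ-1)) (B := 1) (fun u hu => ?_) zero_le_one
      · have : (fun v u => G v u / u) = fun (v u : ℝ) => G v u * u ^ (-1:ℝ) := by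
          funext v u; rw [Real.rpow_neg_one]; rfl
        rw [this]; exact e
      · rw [one_mul, Wt, Wt, Real.rpow_sub_one hu.ne', Real.rpow_neg_one]
        apply le_of_eq; ring
    obtain ⟨C, hC, hC'⟩ := ih (γ-1) _ (by push_cast at hγ; linarith) hG2
    refine ⟨A + C, by positivity, fun v hv y hy => ?_⟩
    have hy' : 0 < 1 / y := by positivity
    have hF0 : Tendsto (F v) atTop (𝓝 0) := by
      have hz : Tendsto (fun u => A * Wt γ u) atTop (𝓝 0) := by
        simpa using (Wt_tendsto γ).const_mul A
      refine squeeze_zero_norm' ?_ hz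
      exact (eventually_gt_atTop 0).mono (fun u hu => hb v hv u hu)
    have := osc_ibp (a := 1/y) hy (fun u hu => hG v hv u (lt_of_lt_of_le hy' hu))
      (hF.integrableOn hv hy') (hG2.integrableOn hv hy') hF0
    refine this.trans ?_
    have b1 : |F v (1/y)| ≤ A * y ^ (-γ) := by
      refine (hb v hv _ hy').trans (mul_le_mul_of_nonneg_left ((Wt_le γ hy').trans ?_) hA)
      rw [one_div, Real.inv_rpow hy.le, ← Real.rpow_neg hy.le]
    have b2 := hC' v hv y hy
    have e : -(γ - 1) - 1 = -γ := by ring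
    rw [e] at b2
    rw [Real.rpow_sub_one hy.ne', ← mul_div_assoc, add_mul]
    exact div_le_div_of_nonneg_right (add_le_add b1 b2) hy.le

lemma osc_main {β : ℝ} {F : ℝ → ℝ → ℝ} (hβ0 : -1 < β) (hβ : β < 3) (h : EC 4 (Wt β) F) :
    ∃ C, 0 ≤ C ∧ ∀ v ∈ Ioc (0:ℝ) 1, ∀ y : ℝ, 0 < y →
      |∫ u in Ioi (0:ℝ), Real.cos (y * u) * F v u| ≤ C * y ^ (-β-1) := by
  obtain ⟨C, hC, hC'⟩ := osc_tail 4 β F (by norm_num; linarith) h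
  obtain ⟨A, hA, hb⟩ := h.bound
  refine ⟨A / (β + 1) + C, add_nonneg (div_nonneg hA (by linarith)) hC, fun v hv y hy => ?_⟩
  have hi := h.integrableOn_zero hβ0 hv
  have hc := integrableOn_cexp_mul hi y
  have hy' : 0 < 1 / y := by positivity
  have e1 : ∫ u in Ioi (0:ℝ), Real.cos (y * u) * F v u =
      (∫ u in Ioi (0:ℝ), Complex.exp (((y * u : ℝ) : ℂ) * Complex.I) * (F v u : ℂ)).re := by
    rw [← RCLike.re_eq_complex_re, ← integral_re hc]
    refine integral_congr_ae (Eventually.of_forall fun u => ?_)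
    simp only [RCLike.re_eq_complex_re, Complex.re_mul_ofReal, Complex.exp_ofReal_mul_I_re]
  rw [e1]
  refine (Complex.abs_re_le_norm _).trans ?_
  rw [← Ioc_union_Ioi_eq_Ioi hy'.le, setIntegral_union (Ioc_disjoint_Ioi le_rfl) measurableSet_Ioi
    (hc.mono_set Ioc_subset_Ioi_self) (hc.mono_set (Ioi_subset_Ioi hy'.le))]
  refine (norm_add_le _ _).trans ?_
  rw [add_mul]
  refine add_le_add ?_ (hC' v hv y hy)
  have h0 : IntegrableOn (fun u : ℝ => u ^ β) (Ioc 0 (1/y)) := by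
    have := intervalIntegral.intervalIntegrable_rpow' (a := 0) (b := 1/y) hβ0
    rwa [intervalIntegrable_iff_integrableOn_Ioc_of_le hy'.le] at this
  have := norm_integral_le_of_norm_le (f := fun u : ℝ =>
      Complex.exp (((y * u : ℝ) : ℂ) * Complex.I) * (F v u : ℂ)) (h0.const_mul A)
      ((ae_restrict_mem measurableSet_Ioc).mono (fun u hu => ?_))
  · refine this.trans (le_of_eq ?_)
    rw [integral_const_mul, ← intervalIntegral.integral_of_le hy'.le, integral_rpow (Or.inl hβ0),
      Real.zero_rpow (by linarith), one_div, Real.inv_rpow hy.le,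
        ← Real.rpow_neg hy.le]
    have e : -β - 1 = -(β + 1) := by ring
    rw [e]
    ring
  · rw [norm_mul, norm_cexp_mul_I, one_mul, Complex.norm_real, Real.norm_eq_abs]
    exact (hb v hv u hu.1).trans (mul_le_mul_of_nonneg_left (Wt_le β hu.1) hA)


/-- Half-line Fourier transform. -/
def OT (k : ℝ → ℝ) (y : ℝ) : ℂ :=
  ∫ u in Ioi (0:ℝ), Complex.exp (((y * u : ℝ) : ℂ) * Complex.I) * (k u : ℂ)

/-- Half-line cosine transform. -/
def CT (k : ℝ → ℝ) (y : ℝ) : ℝ := ∫ u in Ioi (0:ℝ), Real.cos (y * u) * k u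

lemma CT_eq_re {k : ℝ → ℝ} (hk : IntegrableOn k (Ioi 0)) (y : ℝ) : CT k y = (OT k y).re := by
  rw [CT, OT, ← RCLike.re_eq_complex_re, ← integral_re (integrableOn_cexp_mul hk y)]
  refine integral_congr_ae (Eventually.of_forall fun u => ?_)
  simp only [RCLike.re_eq_complex_re, Complex.re_mul_ofReal, Complex.exp_ofReal_mul_I_re]

lemma OT_hasDerivAt {k : ℝ → ℝ} (hk : IntegrableOn k (Ioi 0))
    (hk1 : IntegrableOn (fun u => u * k u) (Ioi 0)) (y : ℝ) :
    HasDerivAt (OT k) (Complex.I * OT (fun u => u * k u) y) y := by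
  have h := hasDerivAt_integral_of_dominated_loc_of_deriv_le (μ := volume.restrict (Ioi (0:ℝ)))
    (F := fun (y u : ℝ) => Complex.exp (((y * u : ℝ) : ℂ) * Complex.I) * (k u : ℂ))
    (F' := fun (y u : ℝ) => Complex.I * (Complex.exp (((y * u : ℝ) : ℂ) * Complex.I)
      * ((u * k u : ℝ) : ℂ))) (x₀ := y) (bound := fun u => |u * k u|) (s := univ)
      univ_mem ?_ ?_ ?_ ?_ ?_ ?_
  · have := h.2
    rw [integral_const_mul] at this
    exact this
  · exact Eventually.of_forall fun z => (integrableOn_cexp_mul hk z).1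
  · exact integrableOn_cexp_mul hk y
  · exact ((integrableOn_cexp_mul hk1 y).const_mul _).1
  · refine Eventually.of_forall fun u z _ => ?_
    rw [norm_mul, norm_mul, norm_cexp_mul_I, Complex.norm_I, one_mul, one_mul, Complex.norm_real,
      Real.norm_eq_abs]
  · exact hk1.norm
  · refine Eventually.of_forall fun u z _ => ?_
    have e1 : HasDerivAt (fun z : ℝ => ((z * u : ℝ) : ℂ) * Complex.I) (u * Complex.I) z := by
      have := ((hasDerivAt_id z).mul_const u).ofReal_comp.mul_const Complex.I
      simpa using this
    refine (e1.cexp.mul_const (k u : ℂ)).congr_deriv ?_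
    push_cast
    ring

lemma OT_ibp {F G : ℝ → ℝ} (hc : ContinuousWithinAt F (Ici 0) 0) (h0 : F 0 = 0)
    (hd : ∀ u ∈ Ioi (0:ℝ), HasDerivAt F (G u) u) (hF : IntegrableOn F (Ioi 0))
    (hG : IntegrableOn G (Ioi 0)) (hF0 : Tendsto F atTop (𝓝 0)) (y : ℝ) :
    y * Complex.I * OT F y = - OT G y := by
  have h1 := integral_Ioi_of_hasDerivAt_of_tendsto (a := (0:ℝ)) (m := (0:ℂ))
    (f := fun u : ℝ => Complex.exp (((y * u : ℝ) : ℂ) * Complex.I) * (F u : ℂ))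
    (f' := fun u : ℝ => (y * Complex.I) * (Complex.exp (((y * u : ℝ) : ℂ) * Complex.I) * (F u : ℂ))
      + Complex.exp (((y * u : ℝ) : ℂ) * Complex.I) * (G u : ℂ)) ?_ ?_ ?_ ?_
  · rw [integral_add ((integrableOn_cexp_mul hF y).const_mul _) (integrableOn_cexp_mul hG y),
      integral_const_mul] at h1
    simp only [h0, Complex.ofReal_zero, mul_zero, sub_zero] at h1
    exact eq_neg_of_add_eq_zero_left h1
  · refine ContinuousWithinAt.mul ?_ ?_
    · exact Continuous.continuousWithinAt (by fun_prop)
    · exact Complex.continuous_ofReal.continuousAt.comp_continuousWithinAt hc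
  · intro u hu
    have e1 : HasDerivAt (fun u : ℝ => ((y * u : ℝ) : ℂ) * Complex.I) (y * Complex.I) u := by
      have := ((hasDerivAt_id u).const_mul y).ofReal_comp.mul_const Complex.I
      simpa using this
    refine (e1.cexp.mul (hd u hu).ofReal_comp).congr_deriv ?_
    ring
  · exact ((integrableOn_cexp_mul hF y).const_mul _).add (integrableOn_cexp_mul hG y)
  · rw [tendsto_zero_iff_norm_tendsto_zero]
    have : Tendsto (fun u => |F u|) atTop (𝓝 0) := by simpa using hF0.abs
    refine this.congr (fun u => ?_)
    rw [norm_mul, norm_cexp_mul_I, one_mul, Complex.norm_real, Real.norm_eq_abs]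

lemma rpow_exp_integrable {a : ℝ} (ha : -1 < a) :
    IntegrableOn (fun u : ℝ => u ^ a * Real.exp (-u)) (Ioi 0) := by
  have := Real.GammaIntegral_convergent (s := a + 1) (by linarith)
  refine this.congr_fun (fun u _ => ?_) measurableSet_Ioi
  simp only [add_sub_cancel_right]
  ring

lemma OT_rpow_exp {a : ℝ} (ha : 0 < a) (y : ℝ) :
    OT (fun u => u ^ a * Real.exp (-u)) y = Real.Gamma (a + 1) *
      Complex.exp ((a + 1) * (-((1/2 * Real.log (1 + y ^ 2) : ℝ) : ℂ)
        + (Real.arctan y : ℂ) * Complex.I)) := by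
  set k : ℝ → ℝ := fun u => u ^ a * Real.exp (-u) with hk
  set k1 : ℝ → ℝ := fun u => u ^ (a+1) * Real.exp (-u) with hk1
  have ik : IntegrableOn k (Ioi 0) := rpow_exp_integrable (by linarith)
  have ik1 : IntegrableOn k1 (Ioi 0) := rpow_exp_integrable (by linarith)
  have hkk : ∀ u ∈ Ioi (0:ℝ), k1 u = u * k u := by
    intro u hu
    simp only [hk, hk1]
    rw [Real.rpow_add_one (ne_of_gt hu)]; ring
  have ik1' : IntegrableOn (fun u => u * k u) (Ioi 0) := ik1.congr_fun hkk measurableSet_Ioi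
  have hOT1 : ∀ y, OT (fun u => u * k u) y = OT k1 y := by
    intro y
    refine setIntegral_congr_fun measurableSet_Ioi (fun u hu => ?_)
    simp only [hkk u hu]
  have hibp : ∀ y : ℝ, (1 - y * Complex.I) * OT k1 y = (a + 1) * OT k y := by
    intro y
    have h := OT_ibp (F := k1) (G := fun u => (a+1) * k u - k1 u) ?_ ?_ ?_ ik1
      ((ik.const_mul _).sub ik1) ?_ y
    · have e : OT (fun u => (a+1) * k u - k1 u) y = (a+1) * OT k y - OT k1 y := by
        rw [OT, OT, OT, ← integral_const_mul, ← integral_sub]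
        · refine integral_congr_ae (Eventually.of_forall fun u => ?_)
          push_cast; ring
        · exact (integrableOn_cexp_mul ik y).const_mul _
        · exact integrableOn_cexp_mul ik1 y
      rw [e] at h
      linear_combination -h
    · refine ContinuousAt.continuousWithinAt ?_
      exact (Real.continuousAt_rpow_const 0 (a+1) (Or.inr (by linarith))).mul (by fun_prop)
    · simp [hk1, Real.zero_rpow (by linarith : a + 1 ≠ 0)]
    · intro u hu
      have := (Real.hasDerivAt_rpow_const (p := a+1) (Or.inl (ne_of_gt hu))).mul
        (hasDerivAt_neg u).exp
      refine this.congr_deriv ?_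
      simp only [hk, hk1, add_sub_cancel_right]
      ring
    · have h := tendsto_rpow_mul_exp_neg_mul_atTop_nhds_zero (a+1) 1 one_pos
      simpa using h
  set M : ℝ → ℂ := fun y => Complex.exp (-((a + 1) * (-((1/2 * Real.log (1 + y ^ 2) : ℝ) : ℂ)
        + (Real.arctan y : ℂ) * Complex.I))) with hM
  have hne : ∀ y : ℝ, (1 - y * Complex.I) ≠ 0 := by
    intro y h
    have := congrArg Complex.re h
    simp at this
  have hMd : ∀ y, HasDerivAt M (M y * (-((a+1) * (Complex.I / (1 - y * Complex.I))))) y := by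
    intro y
    have e1 : HasDerivAt (fun y : ℝ => 1/2 * Real.log (1 + y^2)) (y / (1 + y^2)) y := by
      have h1 : HasDerivAt (fun y : ℝ => 1 + y^2) (2 * y) y := by
        have := (hasDerivAt_pow 2 y).const_add 1
        simpa using this
      refine ((h1.log (by positivity)).const_mul (1/2)).congr_deriv ?_
      ring
    have e2 := Real.hasDerivAt_arctan y
    have e3 := ((e1.ofReal_comp.neg.add (e2.ofReal_comp.mul_const Complex.I)).const_mul
      ((a:ℂ)+1)).neg.cexp
    refine e3.congr_deriv ?_
    have h2 : -((y / (1 + y^2) : ℝ) : ℂ) + ((1 / (1 + y^2) : ℝ) : ℂ) * Complex.I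
        = Complex.I / (1 - y * Complex.I) := by
      rw [eq_div_iff (hne y)]
      have h3 : (1 + (y:ℂ)^2) ≠ 0 := by
        have : (1 + y^2) ≠ 0 := by positivity
        exact_mod_cast this
      push_cast
      field_simp
      linear_combination (-(y:ℂ)) * Complex.I_sq
    rw [h2]
    rfl
  have hconst : ∀ y, HasDerivAt (fun y => OT k y * M y) 0 y := by
    intro y
    refine ((OT_hasDerivAt ik ik1' y).mul (hMd y)).congr_deriv ?_
    rw [hOT1]
    have h1 : OT k1 y = (a+1) * OT k y / (1 - y * Complex.I) := by
      rw [eq_div_iff (hne y), mul_comm, hibp]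
    rw [h1]
    have := hne y
    field_simp
    ring
  have heq := is_const_of_deriv_eq_zero (f := fun y => OT k y * M y)
    (fun y => (hconst y).differentiableAt) (fun y => (hconst y).deriv) y 0
  have hM0 : M 0 = 1 := by
    simp only [hM]
    rw [Real.arctan_zero]
    simp
  have hO0 : OT k 0 = Real.Gamma (a+1) := by
    rw [Real.Gamma_eq_integral (by linarith), OT, ← integral_complex_ofReal]
    refine integral_congr_ae (Eventually.of_forall fun u => ?_)
    simp [hk, mul_comm]
  simp only [hM0, hO0, mul_one] at heq
  rw [← heq, mul_assoc, hM, ← Complex.exp_add]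
  simp

lemma CT_rpow_exp {a : ℝ} (ha : 0 < a) (y : ℝ) :
    CT (fun u => u ^ a * Real.exp (-u)) y = Real.Gamma (a + 1) *
      (Real.exp (-((a + 1) * (1/2 * Real.log (1 + y ^ 2)))) *
        Real.cos ((a+1) * Real.arctan y)) := by
  rw [CT_eq_re (rpow_exp_integrable (by linarith)), OT_rpow_exp ha, Complex.re_ofReal_mul]
  congr 1
  have e : ((a:ℂ) + 1) * (-((1/2 * Real.log (1 + y ^ 2) : ℝ) : ℂ)
        + (Real.arctan y : ℂ) * Complex.I) =
      ((-((a + 1) * (1/2 * Real.log (1 + y ^ 2))) : ℝ) : ℂ)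
        + (((a+1) * Real.arctan y : ℝ) : ℂ) * Complex.I := by push_cast; ring
  rw [e, Complex.exp_add, ← Complex.ofReal_exp, Complex.re_ofReal_mul, Complex.exp_ofReal_mul_I_re]


lemma arctan_near {y : ℝ} (hy : 1 ≤ y) : |Real.arctan y - Real.pi / 2| ≤ 1 / y := by
  have h := Real.arctan_inv_of_pos (show 0 < y by linarith)
  have h1 : Real.arctan y - Real.pi / 2 = - Real.arctan y⁻¹ := by rw [h]; ring
  have h2 : 0 ≤ Real.arctan y⁻¹ := by
    rw [← Real.arctan_zero]; exact Real.arctan_strictMono.monotone (by positivity)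
  rw [h1, abs_neg, abs_of_nonneg h2]
  have h3 := Real.le_tan h2 (Real.arctan_lt_pi_div_two _)
  rw [Real.tan_arctan] at h3
  simpa using h3

lemma halflog_near {y : ℝ} (hy : 1 ≤ y) : 0 ≤ 1/2 * Real.log (1 + y^2) - Real.log y ∧
    1/2 * Real.log (1 + y^2) - Real.log y ≤ 1 / y := by
  have hy0 : 0 < y := by linarith
  have e : 1/2 * Real.log (1 + y^2) - Real.log y = 1/2 * Real.log (1 + (1/y)^2) := by
    have h1 : 1 + y^2 = y^2 * (1 + (1/y)^2) := by field_simp; ring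
    rw [h1, Real.log_mul (by positivity) (by positivity), Real.log_pow]
    push_cast; ring
  rw [e]
  have h2 : 0 ≤ 1 / y := by positivity
  have h3 : 1 / y ≤ 1 := by rw [div_le_one hy0]; exact hy
  constructor
  · have := Real.log_nonneg (show 1 ≤ 1 + (1/y)^2 by nlinarith)
    linarith
  · have := Real.log_le_sub_one_of_pos (show 0 < 1 + (1/y)^2 by positivity)
    nlinarith

/-- basic approximations as `y → ∞` -/
lemma gam_approx {α : ℝ} (hα : α ∈ Ioo (0:ℝ) 2) {y : ℝ} (hy : 1 ≤ y) :
    let E := Real.exp (-((α + 1) * (1/2 * Real.log (1 + y ^ 2))))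
    let Y := y ^ (-α - 1)
    let C := Real.cos ((α+1) * Real.arctan y)
    let S := Real.sin ((α+1) * Real.arctan y)
    let C1 := Real.cos ((α+1) * (Real.pi / 2))
    let S1 := Real.sin ((α+1) * (Real.pi / 2))
    |E * C - Y * C1| ≤ 6 * (Y * (1 / y)) ∧
    |E * (Real.arctan y * S) - Y * (Real.pi / 2 * S1)| ≤ 13 * (Y * (1 / y)) ∧
    |(1/2 * Real.log (1 + y ^ 2)) * (E * C) - Real.log y * (Y * C1)|
      ≤ (1 + 6 * Real.log y) * (Y * (1 / y)) := by
  intro E Y C S C1 S1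
  obtain ⟨h0, h2⟩ := hα
  have hy0 : 0 < y := by linarith
  obtain ⟨hl0, hl1⟩ := halflog_near hy
  have hth := arctan_near hy
  set l := 1/2 * Real.log (1 + y ^ 2) with hl
  set th := Real.arctan y with hthd
  have hL : 0 ≤ Real.log y := Real.log_nonneg hy
  have hY0 : 0 < Y := Real.rpow_pos_of_pos hy0 _
  have hYe : Y = Real.exp (-((α + 1) * Real.log y)) := by
    simp only [Y]; rw [Real.rpow_def_of_pos hy0]; congr 1; ring
  have hE0 : 0 < E := Real.exp_pos _
  have hEY : E ≤ Y := by
    rw [hYe]; apply Real.exp_le_exp.2; nlinarith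
  have hEY2 : Y - E ≤ 3 * (Y * (1/y)) := by
    have : E = Y * Real.exp (-((α+1) * (l - Real.log y))) := by
      rw [hYe, ← Real.exp_add]; simp only [E]; congr 1; ring
    have h3 := Real.add_one_le_exp (-((α+1) * (l - Real.log y)))
    have h4 : (α+1) * (l - Real.log y) ≤ 3 * (1/y) := by
      apply mul_le_mul (by linarith) hl1 hl0 (by norm_num)
    rw [this]
    nlinarith
  have hab : |E - Y| ≤ 3 * (Y * (1/y)) := by rw [abs_sub_comm, abs_of_nonneg (by linarith)]; exact hEY2
  have hC : |C| ≤ 1 := Real.abs_cos_le_one _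
  have hS : |S| ≤ 1 := Real.abs_sin_le_one _
  have hiy : 0 ≤ 1 / y := by positivity
  have harg : |(α+1) * th - (α+1) * (Real.pi/2)| ≤ 3 * (1/y) := by
    rw [← mul_sub, abs_mul, abs_of_pos (by linarith : 0 < α + 1)]
    exact mul_le_mul (by linarith) hth (abs_nonneg _) (by norm_num)
  have hCC : |C - C1| ≤ 3 * (1/y) := (Real.abs_cos_sub_cos_le _ _).trans harg
  have hSS : |S - S1| ≤ 3 * (1/y) := (Real.abs_sin_sub_sin_le _ _).trans harg
  have hth0 : 0 ≤ th := by rw [hthd, ← Real.arctan_zero]; exact Real.arctan_strictMono.monotone hy0.le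
  have hpi : Real.pi / 2 ≤ 2 := by linarith [Real.pi_le_four]
  have hth2 : th ≤ 2 := (Real.arctan_lt_pi_div_two y).le.trans hpi
  have hYy : 0 ≤ Y * (1/y) := by positivity
  have A1 : |E * C - Y * C1| ≤ 6 * (Y * (1 / y)) := by
    have e : E * C - Y * C1 = (E - Y) * C + Y * (C - C1) := by ring
    rw [e]
    refine (abs_add_le _ _).trans ?_
    rw [abs_mul, abs_mul, abs_of_pos hY0]
    have a1 : |E - Y| * |C| ≤ 3 * (Y * (1/y)) * 1 := mul_le_mul hab hC (abs_nonneg _) (by positivity)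
    have a2 : Y * |C - C1| ≤ Y * (3 * (1/y)) := mul_le_mul_of_nonneg_left hCC hY0.le
    linarith
  refine ⟨A1, ?_, ?_⟩
  · have e : E * (th * S) - Y * (Real.pi / 2 * S1)
        = (E - Y) * (th * S) + Y * ((th - Real.pi/2) * S) + Y * (Real.pi/2 * (S - S1)) := by ring
    rw [e]
    refine (abs_add_three _ _ _).trans ?_
    simp only [abs_mul]
    rw [abs_of_pos hY0, abs_of_nonneg hth0, abs_of_pos (show 0 < Real.pi / 2 by positivity)]
    have a1 : |E - Y| * (th * |S|) ≤ 3 * (Y * (1/y)) * (2 * 1) :=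
      mul_le_mul hab (mul_le_mul hth2 hS (abs_nonneg _) (by norm_num)) (by positivity) (by positivity)
    have a2 : Y * (|th - Real.pi/2| * |S|) ≤ Y * (1/y * 1) :=
      mul_le_mul_of_nonneg_left (mul_le_mul hth hS (abs_nonneg _) hiy) hY0.le
    have a3 : Y * (Real.pi/2 * |S - S1|) ≤ Y * (2 * (3 * (1/y))) :=
      mul_le_mul_of_nonneg_left (mul_le_mul hpi hSS (abs_nonneg _) (by norm_num)) hY0.le
    linarith
  · have e : l * (E * C) - Real.log y * (Y * C1)
        = (l - Real.log y) * (E * C) + Real.log y * (E * C - Y * C1) := by ring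
    rw [e]
    refine (abs_add_le _ _).trans ?_
    simp only [abs_mul]
    rw [abs_of_nonneg hl0, abs_of_pos hE0, abs_of_nonneg hL]
    have a1 : (l - Real.log y) * (E * |C|) ≤ (1/y) * (Y * 1) :=
      mul_le_mul hl1 (mul_le_mul hEY hC (abs_nonneg _) hY0.le) (by positivity) hiy
    have a2 : Real.log y * |E * C - Y * C1| ≤ Real.log y * (6 * (Y * (1/y))) :=
      mul_le_mul_of_nonneg_left A1 hL
    linarith

lemma cAlpha_eq {a : ℝ} (ha : a ∈ Ioo (0:ℝ) 2) :
    cAlpha a = -(Real.Gamma (a+1) * Real.cos ((a+1) * (Real.pi/2))) / Real.pi := by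
  obtain ⟨h0, h2⟩ := ha
  have hpi := Real.pi_pos
  have e : Real.cos ((a+1) * (Real.pi/2)) = - Real.sin (Real.pi * a / 2) := by
    rw [← Real.cos_add_pi_div_two]; congr 1; ring
  rw [e]
  unfold cAlpha
  split_ifs with h
  · subst h
    have : Real.Gamma (1+1) = 1 := by
      have := Real.Gamma_two; norm_num at this ⊢
    rw [this]
    simp
  · have hr := Real.Gamma_mul_Gamma_one_sub (a - 1)
    have g1 : Real.Gamma (a+1) = a * ((a-1) * Real.Gamma (a-1)) := by
      rw [Real.Gamma_add_one h0.ne']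
      have := Real.Gamma_add_one (s := a - 1) (sub_ne_zero.2 h)
      rw [sub_add_cancel] at this
      rw [this]
    have e1 : 1 - (a - 1) = 2 - a := by ring
    have hs : Real.sin (Real.pi * (a-1)) = - (2 * Real.sin (Real.pi*a/2) * Real.cos (Real.pi*a/2)) := by
      rw [← Real.sin_two_mul, ← Real.sin_sub_pi]; congr 1; ring
    rw [e1, hs] at hr
    have hG : 0 < Real.Gamma (2 - a) := Real.Gamma_pos_of_pos (by linarith)
    have hsin : Real.sin (Real.pi*a/2) ≠ 0 := by
      apply ne_of_gt; apply Real.sin_pos_of_pos_of_lt_pi <;> nlinarith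
    have hcos : Real.cos (Real.pi*a/2) ≠ 0 := by
      rcases lt_or_gt_of_ne h with h' | h'
      · apply ne_of_gt; apply Real.cos_pos_of_mem_Ioo; constructor <;> nlinarith
      · apply ne_of_lt; apply Real.cos_neg_of_pi_div_two_lt_of_lt <;> nlinarith
    rw [g1]
    rw [eq_div_iff (by simp [hsin, hcos])] at hr
    rw [div_eq_div_iff (by positivity) hpi.ne']
    linear_combination ((a * (a-1))) * hr

lemma cAlpha_pos {a : ℝ} (ha : a ∈ Ioo (0:ℝ) 2) : 0 < cAlpha a := by
  rw [cAlpha_eq ha]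
  have e : Real.cos ((a+1) * (Real.pi/2)) = - Real.sin (Real.pi * a / 2) := by
    rw [← Real.cos_add_pi_div_two]; congr 1; ring
  rw [e]
  have hpi := Real.pi_pos
  have := Real.Gamma_pos_of_pos (show 0 < a+1 by linarith [ha.1])
  have : 0 < Real.sin (Real.pi*a/2) := by
    apply Real.sin_pos_of_pos_of_lt_pi <;> nlinarith [ha.1, ha.2]
  rw [mul_neg, neg_neg]
  positivity

lemma Gamma_hasDeriv {a : ℝ} (ha : 0 < a) :
    HasDerivAt (fun a => Real.Gamma (a+1)) (deriv Real.Gamma (a+1)) a := by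
  have h : DifferentiableAt ℝ Real.Gamma (a+1) := Real.differentiableAt_Gamma (fun m => by
    have : (0:ℝ) ≤ m := m.cast_nonneg
    linarith)
  exact h.hasDerivAt.comp_add_const a 1

lemma deriv_cAlpha {α : ℝ} (hα : α ∈ Ioo (0:ℝ) 2) :
    deriv cAlpha α = -(deriv Real.Gamma (α+1) * Real.cos ((α+1) * (Real.pi/2))
      - Real.Gamma (α+1) * (Real.pi/2 * Real.sin ((α+1) * (Real.pi/2)))) / Real.pi := by
  have h : cAlpha =ᶠ[𝓝 α] fun a => -(Real.Gamma (a+1) * Real.cos ((a+1) * (Real.pi/2))) / Real.pi := by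
    filter_upwards [isOpen_Ioo.mem_nhds hα] with a ha using cAlpha_eq ha
  rw [h.deriv_eq]
  have h1 : HasDerivAt (fun a : ℝ => (a+1) * (Real.pi/2)) (1 * (Real.pi/2)) α :=
    ((hasDerivAt_id α).add_const 1).mul_const _
  have := (((Gamma_hasDeriv hα.1).mul h1.cos).neg.div_const Real.pi).deriv
  refine this.trans ?_
  ring


lemma CT_log_rpow_exp {α : ℝ} (hα : 0 < α) (y : ℝ) :
    CT (fun u => u ^ α * Real.log u * Real.exp (-u)) y =
      deriv Real.Gamma (α+1) * (Real.exp (-((α + 1) * (1/2 * Real.log (1 + y ^ 2)))) *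
        Real.cos ((α+1) * Real.arctan y))
      - Real.Gamma (α+1) * ((1/2 * Real.log (1 + y ^ 2)) *
        (Real.exp (-((α + 1) * (1/2 * Real.log (1 + y ^ 2)))) * Real.cos ((α+1) * Real.arctan y)))
      - Real.Gamma (α+1) * (Real.exp (-((α + 1) * (1/2 * Real.log (1 + y ^ 2)))) *
          (Real.arctan y * Real.sin ((α+1) * Real.arctan y))) := by
  set l := 1/2 * Real.log (1 + y ^ 2) with hl
  set th := Real.arctan y with hth
  set f : ℝ → ℂ := fun t => ((Real.cos (y * t) * Real.exp (-t) : ℝ) : ℂ) with hf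
  have hfc : Continuous f := by
    simp only [hf]; fun_prop
  have hm := mellin_hasDerivAt_of_isBigO_rpow (f := f) (s := ((α + 1 : ℝ) : ℂ)) (a := α + 2) (b := 0)
    (hfc.locallyIntegrable.locallyIntegrableOn _) ?_ (by simp) ?_ (by simp; linarith)
  · have h1 := hm.2.real_of_complex
    have hmel : ∀ x : ℝ, 1 < x → (mellin f (x:ℂ)).re = Real.Gamma x *
        (Real.exp (-(x * l)) * Real.cos (x * th)) := by
      intro x hx
      have h := CT_rpow_exp (a := x - 1) (by linarith) y
      rw [sub_add_cancel] at h
      rw [← h]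
      have : mellin f (x:ℂ) = ((CT (fun u => u ^ (x-1) * Real.exp (-u)) y : ℝ) : ℂ) := by
        rw [mellin, CT, ← integral_complex_ofReal]
        refine setIntegral_congr_fun measurableSet_Ioi fun u hu => ?_
        simp only [hf, smul_eq_mul]
        rw [show ((x:ℂ) - 1) = ((x - 1 : ℝ) : ℂ) by push_cast; ring,
          ← Complex.ofReal_cpow (le_of_lt hu), ← Complex.ofReal_mul]
        congr 1; ring
      rw [this, Complex.ofReal_re]
    have hlog : mellin (fun t => Real.log t • f t) ((α + 1 : ℝ) : ℂ)
        = ((CT (fun u => u ^ α * Real.log u * Real.exp (-u)) y : ℝ) : ℂ) := by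
      rw [mellin, CT, ← integral_complex_ofReal]
      refine setIntegral_congr_fun measurableSet_Ioi fun u hu => ?_
      simp only [hf, smul_eq_mul]
      rw [show (((α + 1 : ℝ) : ℂ) - 1) = ((α : ℝ) : ℂ) by push_cast; ring,
        ← Complex.ofReal_cpow (le_of_lt hu), Complex.real_smul, ← Complex.ofReal_mul, ← Complex.ofReal_mul]
      congr 1; ring
    rw [hlog, Complex.ofReal_re] at h1
    have h2 : HasDerivAt (fun x : ℝ => Real.Gamma x * (Real.exp (-(x * l)) * Real.cos (x * th)))
      (deriv Real.Gamma (α+1) * (Real.exp (-((α + 1) * l)) * Real.cos ((α+1) * th))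
      - Real.Gamma (α+1) * (l * (Real.exp (-((α + 1) * l)) * Real.cos ((α+1) * th)))
      - Real.Gamma (α+1) * (Real.exp (-((α + 1) * l)) *
          (th * Real.sin ((α+1) * th)))) (α+1) := by
      have g : DifferentiableAt ℝ Real.Gamma (α+1) := Real.differentiableAt_Gamma (fun m => by
        have : (0:ℝ) ≤ m := m.cast_nonneg
        linarith)
      have e1 := ((hasDerivAt_id (α+1)).mul_const l).neg.exp
      have e2 := ((hasDerivAt_id (α+1)).mul_const th).cos
      refine (g.hasDerivAt.mul (e1.mul e2)).congr_deriv ?_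
      simp only [id, Pi.neg_apply, Pi.mul_apply]
      ring
    have h3 : (fun x : ℝ => (mellin f (x:ℂ)).re) =ᶠ[𝓝 (α+1)]
        (fun x : ℝ => Real.Gamma x * (Real.exp (-(x * l)) * Real.cos (x * th))) := by
      filter_upwards [isOpen_Ioi.mem_nhds (show α + 1 ∈ Ioi (1:ℝ) by simp [hα])] with x hx
        using hmel x hx
    exact (h1.congr_of_eventuallyEq h3.symm).unique h2
  · have h0 := isLittleO_exp_neg_mul_rpow_atTop (a := 1) one_pos (-(α+2))
    refine Asymptotics.IsBigO.trans (Asymptotics.isBigO_of_le _ fun t => ?_) h0.isBigO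
    simp only [hf, Complex.norm_real, Real.norm_eq_abs, abs_mul]
    rw [neg_one_mul]
    exact mul_le_of_le_one_left (abs_nonneg _) (Real.abs_cos_le_one _)
  · simp only [neg_zero, Real.rpow_zero]
    exact (hfc.continuousAt.isBigO_one ℝ).mono nhdsWithin_le_nhds

lemma CT_asymp1 {α : ℝ} (hα : α ∈ Ioo (0:ℝ) 2) : ∃ K ≥ 0, ∀ y ≥ 1,
    |1 / Real.pi * CT (fun u => u ^ α * Real.exp (-u)) y + cAlpha α * y ^ (-α-1)|
      ≤ K * (y ^ (-(1/2):ℝ) * y ^ (-α-1)) := by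
  refine ⟨1/Real.pi * (Real.Gamma (α+1) * 6), ?_, fun y hy => ?_⟩
  · have := Real.Gamma_pos_of_pos (show 0 < α+1 by linarith [hα.1])
    positivity
  have hG := Real.Gamma_pos_of_pos (show 0 < α+1 by linarith [hα.1])
  have h := (gam_approx hα hy).1
  rw [CT_rpow_exp hα.1, cAlpha_eq hα]
  set X := Real.exp (-((α + 1) * (1/2 * Real.log (1 + y ^ 2)))) * Real.cos ((α+1) * Real.arctan y)
  set C1 := Real.cos ((α+1) * (Real.pi / 2))
  have e : 1 / Real.pi * (Real.Gamma (α+1) * X) + -(Real.Gamma (α+1) * C1) / Real.pi * y ^ (-α-1)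
    = 1/Real.pi * (Real.Gamma (α+1) * (X - y ^ (-α-1) * C1)) := by ring
  rw [e, abs_mul, abs_mul, abs_of_pos hG, abs_of_pos (show 0 < 1/Real.pi by positivity), mul_assoc, mul_assoc]
  have hy0 : 0 < y := by linarith
  have hs : 1 / y ≤ y ^ (-(1/2):ℝ) := by
    rw [one_div, ← Real.rpow_neg_one]
    exact Real.rpow_le_rpow_of_exponent_le hy (by norm_num)
  gcongr
  refine h.trans ?_
  rw [mul_comm (y ^ (-(1/2):ℝ))]
  gcongr

lemma CT_asymp2 {α : ℝ} (hα : α ∈ Ioo (0:ℝ) 2) : ∃ K ≥ 0, ∀ y ≥ 1,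
    |1 / Real.pi * CT (fun u => u ^ α * Real.log u * Real.exp (-u)) y
      + (deriv cAlpha α - cAlpha α * Real.log y) * y ^ (-α-1)|
      ≤ K * (y ^ (-(1/2):ℝ) * y ^ (-α-1)) := by
  have hG := Real.Gamma_pos_of_pos (show 0 < α+1 by linarith [hα.1])
  refine ⟨1/Real.pi * (|deriv Real.Gamma (α+1)| * 6 + Real.Gamma (α+1) * 26), ?_, fun y hy => ?_⟩
  · positivity
  obtain ⟨h1, h2, h3⟩ := gam_approx hα hy
  rw [CT_log_rpow_exp hα.1, cAlpha_eq hα, deriv_cAlpha hα]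
  set E := Real.exp (-((α + 1) * (1/2 * Real.log (1 + y ^ 2)))) 
  set C := Real.cos ((α+1) * Real.arctan y)
  set S := Real.sin ((α+1) * Real.arctan y)
  set C1 := Real.cos ((α+1) * (Real.pi / 2))
  set S1 := Real.sin ((α+1) * (Real.pi / 2))
  set Y := y ^ (-α-1)
  set l := 1/2 * Real.log (1 + y ^ 2)
  set L := Real.log y
  set th := Real.arctan y
  set G := Real.Gamma (α+1)
  set G' := deriv Real.Gamma (α+1)
  have hy0 : 0 < y := by linarith
  have hY0 : 0 < Y := Real.rpow_pos_of_pos hy0 _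
  have e : 1 / Real.pi * (G' * (E * C) - G * (l * (E * C)) - G * (E * (th * S))) +
      (-(G' * C1 - G * (Real.pi / 2 * S1)) / Real.pi - -(G * C1) / Real.pi * L) * Y
    = 1/Real.pi * (G' * (E * C - Y * C1) - G * (l * (E*C) - L * (Y * C1))
        - G * (E * (th * S) - Y * (Real.pi/2 * S1))) := by ring
  rw [e, abs_mul, abs_of_pos (show 0 < 1/Real.pi by positivity),
    mul_assoc (1/Real.pi) (|G'| * 6 + G * 26)]
  refine mul_le_mul_of_nonneg_left ?_ (le_of_lt (show 0 < 1/Real.pi by positivity))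
  have hs : 1 / y ≤ y ^ (-(1/2):ℝ) := by
    rw [one_div, ← Real.rpow_neg_one]
    exact Real.rpow_le_rpow_of_exponent_le hy (by norm_num)
  have hL : L * (1/y) ≤ 2 * y ^ (-(1/2):ℝ) := by
    have := Real.log_le_rpow_div hy0.le (show (0:ℝ) < 1/2 by norm_num)
    have e2 : y ^ (-(1/2):ℝ) = y ^ ((1/2):ℝ) * (1/y) := by
      rw [one_div y, ← Real.rpow_neg_one y, ← Real.rpow_add hy0]; norm_num
    rw [e2, ← mul_assoc]
    refine mul_le_mul_of_nonneg_right ?_ (by positivity)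
    simp only [L]; linarith
  set s := y ^ (-(1/2):ℝ)
  have b1 : |E * C - Y * C1| ≤ 6 * (s * Y) := by
    refine h1.trans ?_
    nlinarith
  have b2 : |E * (th * S) - Y * (Real.pi/2 * S1)| ≤ 13 * (s * Y) := by
    refine h2.trans ?_
    nlinarith
  have b3 : |l * (E*C) - L * (Y * C1)| ≤ 13 * (s * Y) := by
    refine h3.trans ?_
    have : (1 + 6 * L) * (Y * (1/y)) = Y * (1/y + 6 * (L * (1/y))) := by ring
    rw [this]
    have : Y * (1/y + 6 * (L * (1/y))) ≤ Y * (s + 6 * (2 * s)) := by gcongr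
    linarith
  refine (abs_sub _ _).trans ?_
  refine (add_le_add_left (abs_sub _ _) _).trans ?_
  rw [abs_mul, abs_mul, abs_mul, abs_of_pos hG]
  have c1 := mul_le_mul_of_nonneg_left b1 (abs_nonneg G')
  have c2 := mul_le_mul_of_nonneg_left b2 hG.le
  have c3 := mul_le_mul_of_nonneg_left b3 hG.le
  linarith


lemma CT_congr {k k' : ℝ → ℝ} (h : ∀ u, 0 < u → k u = k' u) (y : ℝ) : CT k y = CT k' y := by
  refine setIntegral_congr_fun measurableSet_Ioi fun u hu => ?_
  simp only [h u hu]

lemma integrableOn_cos_mul {k : ℝ → ℝ} (hk : IntegrableOn k (Ioi 0)) (y : ℝ) :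
    IntegrableOn (fun u => Real.cos (y * u) * k u) (Ioi 0) := by
  refine Integrable.bdd_mul (c := 1) hk ?_ ?_
  · exact Continuous.aestronglyMeasurable (by fun_prop)
  · exact Eventually.of_forall (fun u => by simpa using Real.abs_cos_le_one _)

lemma CT_add {k k' : ℝ → ℝ} (hk : IntegrableOn k (Ioi 0)) (hk' : IntegrableOn k' (Ioi 0)) (y : ℝ) :
    CT (fun u => k u + k' u) y = CT k y + CT k' y := by
  simp only [CT]
  rw [← integral_add (integrableOn_cos_mul hk y) (integrableOn_cos_mul hk' y)]
  simp only [mul_add]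

lemma CT_const_mul (c : ℝ) (k : ℝ → ℝ) (y : ℝ) :
    CT (fun u => c * k u) y = c * CT k y := by
  simp only [CT]
  rw [← integral_const_mul]
  congr 1; ext u; ring

lemma CT_neg_arg (k : ℝ → ℝ) (y : ℝ) : CT k (-y) = CT k y := by
  simp only [CT, neg_mul, Real.cos_neg]

lemma CT_abs_arg (k : ℝ → ℝ) (y : ℝ) : CT k |y| = CT k y := by
  rcases abs_choice y with h | h
  · rw [h]
  · rw [h, CT_neg_arg]

lemma CT_abs_le {k : ℝ → ℝ} (hk : IntegrableOn k (Ioi 0)) (y : ℝ) :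
    |CT k y| ≤ ∫ u in Ioi (0:ℝ), |k u| := by
  refine (abs_integral_le_integral_abs).trans ?_
  refine integral_mono (integrableOn_cos_mul hk y).abs hk.abs fun u => ?_
  simp only [abs_mul]
  exact mul_le_of_le_one_left (abs_nonneg _) (Real.abs_cos_le_one _)

lemma CT_continuous {k : ℝ → ℝ} (hk : IntegrableOn k (Ioi 0)) : Continuous (CT k) := by
  refine continuous_of_dominated (bound := fun u => |k u|) ?_ ?_ ?_ ?_
  · intro y; exact (integrableOn_cos_mul hk y).1
  · intro y
    refine Eventually.of_forall fun u => ?_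
    simp only [Real.norm_eq_abs, abs_mul]
    exact mul_le_of_le_one_left (abs_nonneg _) (Real.abs_cos_le_one _)
  · exact hk.abs
  · refine Eventually.of_forall fun u => by fun_prop

lemma wt_dom (β s : ℝ) (hs : 0 < s) : ∃ B, 0 ≤ B ∧ ∀ u : ℝ, 0 < u →
    (1 + |Real.log u|) * (u ^ (β + s) * Real.exp (-(1/2 * u))) ≤ B * Wt β u := by
  obtain ⟨B, hB, h⟩ := log_rpow_exp_bdd (1/4) (by norm_num) s hs
  refine ⟨B, hB, fun u hu => ?_⟩
  have e : (1 + |Real.log u|) * (u ^ (β + s) * Real.exp (-(1/2 * u))) =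
      ((1 + |Real.log u|) * (u ^ s * Real.exp (-(1/4 * u)))) * Wt β u := by
    rw [Wt, Real.rpow_add hu, show -(1/2 * u) = -(1/4*u) + -(1/4*u) by ring, Real.exp_add]; ring
  rw [e]
  exact mul_le_mul_of_nonneg_right (h u hu) (Wt_nonneg β hu)

lemma wt_dom' (β s : ℝ) (hs : 0 < s) : ∃ B, 0 ≤ B ∧ ∀ u : ℝ, 0 < u →
    (u ^ (β + s) * Real.exp (-(1/2 * u))) ≤ B * Wt β u := by
  obtain ⟨B, hB, h⟩ := wt_dom β s hs
  refine ⟨B, hB, fun u hu => le_trans ?_ (h u hu)⟩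
  have : 0 ≤ u ^ (β + s) * Real.exp (-(1/2 * u)) :=
    mul_nonneg (Real.rpow_nonneg hu.le _) (Real.exp_pos _).le
  exact le_mul_of_one_le_left this (by linarith [abs_nonneg (Real.log u)])

lemma EC_K1 (α : ℝ) : EC 4 (Wt (α + 1/2))
    (fun _ u => u ^ α * (Real.exp (-(u^2)/2) - Real.exp (-u))) := by
  obtain ⟨B, hB, h⟩ := wt_dom' (α + 1/2) (1/2) (by norm_num)
  refine ((EC_rpow 4 α).mul (EC_d0 4)).mono (B := B) (fun u hu => ?_) hB
  refine le_trans (le_of_eq ?_) (h u hu)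
  rw [show α + 1/2 + 1/2 = α + 1 by ring, Real.rpow_add hu]; ring

lemma EC_K2 (α : ℝ) : EC 4 (Wt (α + 1/2))
    (fun _ u => Real.log u * (u ^ α * (Real.exp (-(u^2)/2) - Real.exp (-u)))) := by
  obtain ⟨B, hB, h⟩ := wt_dom (α + 1/2) (1/2) (by norm_num)
  refine ((EC_log 4).mul ((EC_rpow 4 α).mul (EC_d0 4))).mono (B := B) (fun u hu => ?_) hB
  refine le_trans (le_of_eq ?_) (h u hu)
  rw [show α + 1/2 + 1/2 = α + 1 by ring, Real.rpow_add hu]; ring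

lemma EC_expSq0 : EC 4 (fun u => Real.exp (-(1/2 * u))) (fun _ u => Real.exp (-(u^2) / 2)) := by
  have := EC_expSq 4 0
  simpa only [pow_zero, one_mul] using this

lemma EC_expv0 (α : ℝ) : EC 4 (fun _ => 1) (fun v u => Real.exp (-(v * u ^ α))) := by
  have := EC_expv α 4 0
  simpa only [pow_zero, one_mul] using this

lemma EC_K3 {α : ℝ} (hα : 0 < α) : EC 4 (Wt α)
    (fun v u => (u ^ α * ((Real.exp (-(v * u ^ α)) - 1) / v)) * Real.exp (-(u^2)/2)) := by
  obtain ⟨B, hB, h⟩ := wt_dom' α α hα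
  refine (((EC_rpow 4 α).mul (EC_g1 α 4)).mul EC_expSq0).mono (B := B) (fun u hu => ?_) hB
  refine le_trans (le_of_eq ?_) (h u hu)
  rw [Real.rpow_add hu]

lemma EC_K4 {α : ℝ} (hα : 0 < α) : EC 4 (Wt α)
    (fun v u => Real.log u * ((u ^ α * ((Real.exp (-(v * u ^ α)) - 1) / v)) * Real.exp (-(u^2)/2))) := by
  obtain ⟨B, hB, h⟩ := wt_dom α α hα
  refine ((EC_log 4).mul (((EC_rpow 4 α).mul (EC_g1 α 4)).mul EC_expSq0)).mono (B := B) (fun u hu => ?_) hB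
  refine le_trans (le_of_eq ?_) (h u hu)
  rw [Real.rpow_add hu]

lemma EC_K5 {α : ℝ} (hα : 0 < α) : EC 4 (Wt α)
    (fun v u => ((1 - Real.exp (-(v * u ^ α)) - v * u ^ α) / v ^ 2) * Real.exp (-(u^2)/2)) := by
  obtain ⟨B, hB, h⟩ := wt_dom' α α hα
  refine ((EC_g2 α 4).mul EC_expSq0).mono (B := B) (fun u hu => ?_) hB
  refine le_trans (le_of_eq ?_) (h u hu)
  rw [Real.rpow_add hu]

/-- the kernels of the three transforms -/
def kP (α v u : ℝ) : ℝ := Real.exp (-(u^2)/2) * (u ^ α * Real.exp (-(v * u ^ α)))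
def kQ (α v u : ℝ) : ℝ := Real.exp (-(u^2)/2) * (u ^ α * Real.log u * Real.exp (-(v * u ^ α)))
def kR (α v u : ℝ) : ℝ := Real.exp (-(u^2)/2) * ((1 - Real.exp (-(v * u ^ α))) / v)

def Pf (α v y : ℝ) : ℝ := 1 / Real.pi * CT (kP α v) y
def Qf (α v y : ℝ) : ℝ := 1 / Real.pi * CT (kQ α v) y
def Rf (α v y : ℝ) : ℝ := 1 / Real.pi * CT (kR α v) y

lemma EC_kP {α : ℝ} (hα : 0 < α) : EC 4 (Wt 0) (kP α) := by
  obtain ⟨B, hB, h⟩ := wt_dom' 0 α hα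
  refine (EC_expSq0.mul ((EC_rpow 4 α).mul (EC_expv0 α))).mono (B := B) (fun u hu => ?_) hB
  refine le_trans (le_of_eq ?_) (h u hu)
  rw [zero_add]; ring

lemma EC_kQ {α : ℝ} (hα : 0 < α) : EC 4 (Wt 0) (kQ α) := by
  obtain ⟨B, hB, h⟩ := wt_dom 0 α hα
  refine (EC_expSq0.mul (((EC_rpow 4 α).mul (EC_log 4)).mul (EC_expv0 α))).mono (B := B)
    (fun u hu => ?_) hB
  refine le_trans (le_of_eq ?_) (h u hu)
  rw [zero_add]; ring

lemma EC_kR {α : ℝ} (hα : 0 < α) : EC 4 (Wt 0) (kR α) := by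
  obtain ⟨B, hB, h⟩ := wt_dom' 0 α hα
  have h1 : EC 4 (Wt 0) (fun v u => Real.exp (-(u^2)/2) * (-1 * ((Real.exp (-(v * u ^ α)) - 1) / v))) := by
    refine (EC_expSq0.mul ((EC_g1 α 4).const_mul (-1))).mono (B := B) (fun u hu => ?_) hB
    refine le_trans (le_of_eq ?_) (h u hu)
    rw [zero_add]; ring
  have e : kR α = (fun v u => Real.exp (-(u^2)/2) * (-1 * ((Real.exp (-(v * u ^ α)) - 1) / v))) := by
    ext v u; rw [kR]; ring
  rw [e]; exact h1

lemma CT_EC_bdd {F : ℝ → ℝ → ℝ} (h : EC 4 (Wt 0) F) :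
    ∃ C, 0 ≤ C ∧ ∀ v ∈ Ioc (0:ℝ) 1, ∀ y, |1 / Real.pi * CT (F v) y| ≤ C := by
  obtain ⟨A, hA, hb⟩ := h.bound
  have hW := Wt_integrableOn_zero 0 (by norm_num)
  refine ⟨1 / Real.pi * ∫ u in Ioi (0:ℝ), A * Wt 0 u, ?_, fun v hv y => ?_⟩
  · have : 0 ≤ ∫ u in Ioi (0:ℝ), A * Wt 0 u :=
      setIntegral_nonneg measurableSet_Ioi fun u hu => mul_nonneg hA (Wt_nonneg 0 hu)
    positivity
  have hi := h.integrableOn_zero (by norm_num) hv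
  rw [abs_mul, abs_of_pos (show 0 < 1/Real.pi by positivity)]
  refine mul_le_mul_of_nonneg_left ((CT_abs_le hi y).trans ?_) (le_of_lt (by positivity))
  exact setIntegral_mono_on hi.abs (hW.const_mul A) measurableSet_Ioi fun u hu => hb v hv u hu

lemma log_rpow_exp_integrable {α : ℝ} (hα : 0 < α) :
    IntegrableOn (fun u : ℝ => u ^ α * Real.log u * Real.exp (-u)) (Ioi 0) := by
  obtain ⟨B, hB, h⟩ := wt_dom 0 α hα
  have h1 : EC 4 (Wt 0) (fun _ u => (u ^ α * Real.log u) * (u ^ 0 * Real.exp (-u))) := by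
    refine (((EC_rpow 4 α).mul (EC_log 4)).mul (EC_exp 4 0)).mono (B := B)
      (fun u hu => ?_) hB
    refine le_trans (le_of_eq ?_) (h u hu)
    rw [zero_add]; ring
  have := h1.integrableOn_zero (by norm_num) (v := 1) (by simp)
  simpa only [pow_zero, one_mul] using this

lemma asymp_combine {p : ℝ} {α : ℝ} (hα : 0 < α) (hα2 : α < 2) {k0 : ℝ → ℝ} (hk0 : IntegrableOn k0 (Ioi 0))
    {K1 : ℝ → ℝ → ℝ} (hK1 : EC 4 (Wt (α + 1/2)) K1) {K3 : ℝ → ℝ → ℝ} (hK3 : EC 4 (Wt α) K3)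
    {M : ℝ → ℝ} {K : ℝ} (hK : 0 ≤ K) (hp : p = 1 / Real.pi)
    (hk : ∀ y ≥ 1, |p * CT k0 y + M y| ≤ K * (y ^ (-(1/2):ℝ) * y ^ (-α-1)))
    {T : ℝ → ℝ → ℝ} (hT : ∀ v ∈ Ioc (0:ℝ) 1, ∀ u, 0 < u → T v u = k0 u + K1 v u + v * K3 v u) :
    ∃ C, 0 ≤ C ∧ ∀ v ∈ Ioc (0:ℝ) 1, ∀ y, 1 ≤ y →
      |p * CT (T v) y + M y| ≤ C * ((y ^ (-(1/2):ℝ) + v) * y ^ (-α-1)) := by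
  obtain ⟨C1, hC1, h1⟩ := osc_main (by linarith) (by linarith) hK1
  obtain ⟨C3, hC3, h3⟩ := osc_main (by linarith) (by linarith) hK3
  have hp0 : 0 < p := by rw [hp]; positivity
  refine ⟨K + p * C1 + p * C3, by positivity, fun v hv y hy => ?_⟩
  have hy0 : 0 < y := by linarith
  have i1 := hK1.integrableOn_zero (by linarith) hv
  have i3 := hK3.integrableOn_zero (by linarith) hv
  rw [CT_congr (hT v hv), CT_add (k := fun u => k0 u + K1 v u) (k' := fun u => v * K3 v u) (hk0.add i1) (i3.const_mul v), CT_add hk0 i1, CT_const_mul]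
  have b0 := hk y hy
  have b1 : |CT (K1 v) y| ≤ C1 * y ^ (-(α + 1/2) - 1) := h1 v hv y hy0
  have b3 : |CT (K3 v) y| ≤ C3 * y ^ (-α - 1) := h3 v hv y hy0
  rw [show -(α + 1/2) - 1 = -(1/2) + (-α - 1) by ring, Real.rpow_add hy0] at b1
  set s := y ^ (-(1/2):ℝ)
  set Y := y ^ (-α-1)
  have hs : 0 ≤ s := Real.rpow_nonneg hy0.le _
  have hY : 0 ≤ Y := Real.rpow_nonneg hy0.le _
  have e : p * (CT k0 y + CT (K1 v) y + v * CT (K3 v) y) + M y =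
    (p * CT k0 y + M y) + p * CT (K1 v) y + p * (v * CT (K3 v) y) := by ring
  rw [e]
  refine (abs_add_three _ _ _).trans ?_
  rw [abs_mul p, abs_mul p, abs_mul v, abs_of_pos hp0, abs_of_pos hv.1]
  have hv0 := hv.1
  have c1 : p * |CT (K1 v) y| ≤ p * (C1 * (s * Y)) := by gcongr
  have c3 : p * (v * |CT (K3 v) y|) ≤ p * (v * (C3 * Y)) := by gcongr
  have d : (K + p * C1 + p * C3) * ((s + v) * Y) = K * (s * Y) + p * (C1 * (s*Y)) + p * (v * (C3 * Y))
     + (K * (v * Y) + p * C1 * (v * Y) + p * C3 * (s * Y)) := by ring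
  rw [d]
  have : 0 ≤ (K * (v * Y) + p * C1 * (v * Y) + p * C3 * (s * Y)) := by positivity
  linarith

lemma Pf_asymp {α : ℝ} (hα : α ∈ Ioo (0:ℝ) 2) : ∃ C, 0 ≤ C ∧ ∀ v ∈ Ioc (0:ℝ) 1, ∀ y, 1 ≤ y →
    |Pf α v y + cAlpha α * y ^ (-α-1)| ≤ C * ((y ^ (-(1/2):ℝ) + v) * y ^ (-α-1)) := by
  obtain ⟨K, hK, h⟩ := CT_asymp1 hα
  refine asymp_combine hα.1 hα.2 (rpow_exp_integrable (by linarith [hα.1])) (EC_K1 α) (EC_K3 hα.1) hK rfl h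
    (fun v hv u hu => ?_)
  have := hv.1
  rw [kP]; field_simp; ring

lemma Rf_asymp {α : ℝ} (hα : α ∈ Ioo (0:ℝ) 2) : ∃ C, 0 ≤ C ∧ ∀ v ∈ Ioc (0:ℝ) 1, ∀ y, 1 ≤ y →
    |Rf α v y + cAlpha α * y ^ (-α-1)| ≤ C * ((y ^ (-(1/2):ℝ) + v) * y ^ (-α-1)) := by
  obtain ⟨K, hK, h⟩ := CT_asymp1 hα
  refine asymp_combine hα.1 hα.2 (rpow_exp_integrable (by linarith [hα.1])) (EC_K1 α) (EC_K5 hα.1) hK rfl h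
    (fun v hv u hu => ?_)
  have := hv.1
  rw [kR]; field_simp; ring

lemma Qf_asymp {α : ℝ} (hα : α ∈ Ioo (0:ℝ) 2) : ∃ C, 0 ≤ C ∧ ∀ v ∈ Ioc (0:ℝ) 1, ∀ y, 1 ≤ y →
    |Qf α v y + (deriv cAlpha α - cAlpha α * Real.log y) * y ^ (-α-1)|
      ≤ C * ((y ^ (-(1/2):ℝ) + v) * y ^ (-α-1)) := by
  obtain ⟨K, hK, h⟩ := CT_asymp2 hα
  refine asymp_combine hα.1 hα.2 (log_rpow_exp_integrable hα.1) (EC_K2 α) (EC_K4 hα.1) hK rfl h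
    (fun v hv u hu => ?_)
  have := hv.1
  rw [kQ]; field_simp; ring


lemma gauss_integrable : Integrable gauss := by
  have := (integrable_exp_neg_mul_sq (b := 1/2) (by norm_num)).const_mul (Real.sqrt (2 * Real.pi))⁻¹
  refine this.congr (Eventually.of_forall fun x => ?_)
  simp only [gauss]
  congr 2; ring

lemma gauss_continuous : Continuous gauss := by
  unfold gauss; fun_prop

lemma gauss_pos (y : ℝ) : 0 < gauss y := by unfold gauss; positivity

lemma gauss_cos (a b : ℝ) : ∫ t, gauss t * Real.cos (a - t * b) = Real.exp (-(b^2)/2) * Real.cos a := by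
  have h := fourierIntegral_gaussian (b := (1/2 : ℂ)) (by norm_num) (-b : ℂ)
  have hsq : ((Real.pi : ℂ) / (1/2)) ^ (1/2 : ℂ) = ((Real.sqrt (2 * Real.pi) : ℝ) : ℂ) := by
    rw [Real.sqrt_eq_rpow, Complex.ofReal_cpow (by positivity)]
    congr 1
    · push_cast; ring
    · push_cast; ring
  rw [hsq] at h
  have hs0 : Real.sqrt (2 * Real.pi) ≠ 0 := by positivity
  have key : ∫ t : ℝ, (gauss t : ℂ) * Complex.exp (((a - t * b : ℝ) : ℂ) * Complex.I) =
      ((Real.exp (-(b^2)/2) : ℝ) : ℂ) * Complex.exp ((a : ℂ) * Complex.I) := by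
    have e : ∀ t : ℝ, (gauss t : ℂ) * Complex.exp (((a - t * b : ℝ) : ℂ) * Complex.I) =
        (((Real.sqrt (2 * Real.pi))⁻¹ : ℝ) : ℂ) * Complex.exp ((a : ℂ) * Complex.I) *
        (Complex.exp (Complex.I * (-b : ℂ) * t) * Complex.exp (-(1/2 : ℂ) * t ^ 2)) := by
      intro t
      rw [gauss, Complex.ofReal_mul, Complex.ofReal_exp]
      rw [mul_assoc, mul_assoc, ← Complex.exp_add, ← Complex.exp_add, ← Complex.exp_add]
      congr 2; push_cast; ring
    simp only [e]
    rw [integral_const_mul, h]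
    have : ((Real.exp (-(b^2)/2) : ℝ) : ℂ) = Complex.exp (-(-b : ℂ)^2 / (4 * (1/2))) := by
      rw [Complex.ofReal_exp]; congr 1; push_cast; ring
    rw [this]
    have h2 : (((Real.sqrt (2 * Real.pi))⁻¹ : ℝ) : ℂ) * ((Real.sqrt (2 * Real.pi) : ℝ) : ℂ) = 1 := by
      rw [← Complex.ofReal_mul, inv_mul_cancel₀ hs0]; simp
    linear_combination (Complex.exp ((a : ℂ) * Complex.I) * Complex.exp (-(-b : ℂ)^2 / (4 * (1/2)))) * h2
  have hInteg : Integrable (fun t : ℝ => (gauss t : ℂ) * Complex.exp (((a - t * b : ℝ) : ℂ) * Complex.I)) := by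
    refine Integrable.mul_bdd (c := 1) gauss_integrable.ofReal ?_ ?_
    · exact Continuous.aestronglyMeasurable (by fun_prop)
    · exact Eventually.of_forall (fun u => (norm_cexp_mul_I _).le)
  have h3 := congrArg Complex.re key
  rw [Complex.re_ofReal_mul, Complex.exp_ofReal_mul_I_re] at h3
  rw [← h3, ← RCLike.re_eq_complex_re, ← integral_re hInteg]
  refine integral_congr_ae (Eventually.of_forall fun u => ?_)
  simp only [RCLike.re_eq_complex_re, Complex.re_ofReal_mul, Complex.exp_ofReal_mul_I_re]

lemma gauss_shift_cos (y w u : ℝ) (hw : 0 < w) :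
    ∫ z, gauss (y - w * z) * Real.cos (z * u) =
      w⁻¹ * (Real.exp (-((w⁻¹ * u)^2)/2) * Real.cos (y * (w⁻¹ * u))) := by
  have h := gauss_cos (y * (w⁻¹ * u)) (w⁻¹ * u)
  rw [← h]
  have h1 := Measure.integral_comp_mul_left (fun x => gauss (y - x) * Real.cos (x * (w⁻¹ * u))) w
  have h2 := integral_sub_left_eq_self (fun t => gauss t * Real.cos (y * (w⁻¹ * u) - t * (w⁻¹ * u))) volume y
  rw [← h2, show w⁻¹ = |w⁻¹| by rw [abs_of_pos (by positivity)], ← smul_eq_mul (|w⁻¹|) (∫ x, _)]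
  rw [abs_of_pos (show 0 < w⁻¹ by positivity)]
  rw [abs_of_pos (show 0 < w⁻¹ by positivity)] at h1
  have e : ∀ x : ℝ, gauss (y - x) * Real.cos (y * (w⁻¹ * u) - (y - x) * (w⁻¹ * u)) =
     gauss (y - x) * Real.cos (x * (w⁻¹ * u)) := by
    intro x; congr 2; ring
  simp only [e]
  rw [← h1]
  congr 1; ext z; congr 2
  field_simp

lemma gauss_conv_CT {k : ℝ → ℝ} (hk : IntegrableOn k (Ioi 0)) (y w : ℝ) (hw : 0 < w) :
    ∫ z, gauss (y - w * z) * CT k z = CT (fun u => Real.exp (-(u^2)/2) * k (w * u)) y := by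
  have hg : Integrable (fun z => gauss (y - w * z)) :=
    ((gauss_integrable.comp_sub_left y).comp_mul_left' hw.ne')
  have hprod : Integrable (fun p : ℝ × ℝ => gauss (y - w * p.1) * (Real.cos (p.1 * p.2) * k p.2))
      (volume.prod (volume.restrict (Ioi 0))) := by
    have h1 : Integrable (fun p : ℝ × ℝ => gauss (y - w * p.1) * k p.2)
      (volume.prod (volume.restrict (Ioi 0))) := hg.mul_prod hk
    have h2 : Integrable (fun p : ℝ × ℝ => Real.cos (p.1 * p.2) * (gauss (y - w * p.1) * k p.2))
      (volume.prod (volume.restrict (Ioi 0))) := by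
      refine Integrable.bdd_mul (c := 1) h1 ?_ ?_
      · exact Continuous.aestronglyMeasurable (by fun_prop)
      · exact Eventually.of_forall (fun u => by simpa using Real.abs_cos_le_one _)
    refine h2.congr (Eventually.of_forall fun p => ?_)
    simp only; ring
  have h1 : ∫ z, gauss (y - w * z) * CT k z
      = ∫ z, ∫ u in Ioi (0:ℝ), gauss (y - w * z) * (Real.cos (z * u) * k u) := by
    congr 1; ext z; rw [CT, integral_const_mul]
  rw [h1, integral_integral_swap hprod]
  have h2 : ∀ u, ∫ z, gauss (y - w * z) * (Real.cos (z * u) * k u) =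
      w⁻¹ * (Real.exp (-((w⁻¹ * u)^2)/2) * Real.cos (y * (w⁻¹ * u))) * k u := by
    intro u
    rw [← gauss_shift_cos y w u hw, ← integral_mul_const]
    congr 1; ext z; ring
  simp only [h2]
  have h3 := integral_comp_mul_left_Ioi
    (fun u => w⁻¹ * (Real.exp (-((w⁻¹ * u)^2)/2) * Real.cos (y * (w⁻¹ * u))) * k u) 0 hw
  rw [mul_zero] at h3
  have h4 : ∫ u in Ioi (0:ℝ), w⁻¹ * (Real.exp (-((w⁻¹ * u)^2)/2) * Real.cos (y * (w⁻¹ * u))) * k u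
     = w * ∫ u in Ioi (0:ℝ), w⁻¹ * (Real.exp (-((w⁻¹ * (w*u))^2)/2) * Real.cos (y * (w⁻¹ * (w*u)))) * k (w*u) := by
    rw [h3, smul_eq_mul, ← mul_assoc w, mul_inv_cancel₀ hw.ne', one_mul]
  rw [h4, CT, ← integral_const_mul]
  congr 1; ext u
  rw [inv_mul_cancel_left₀ hw.ne']
  field_simp

lemma gauss_eq_CT (y : ℝ) : gauss y = 1 / Real.pi * CT (fun u => Real.exp (-(u^2)/2)) y := by
  have h := gauss_cos 0 y
  have e : ∀ t : ℝ, gauss t * Real.cos (0 - t * y) =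
      (fun t => gauss t * Real.cos (y * t)) |t| := by
    intro t
    simp only [gauss, sq_abs]
    rw [zero_sub, Real.cos_neg]
    rcases abs_choice t with h | h
    · rw [h, mul_comm y]
    · rw [h, mul_neg, Real.cos_neg, mul_comm y]
  rw [integral_congr_ae (Eventually.of_forall e), integral_comp_abs (f := fun t => gauss t * Real.cos (y * t)), Real.cos_zero, mul_one] at h
  have h2 : ∫ t in Ioi (0:ℝ), gauss t * Real.cos (y * t) =
      (Real.sqrt (2 * Real.pi))⁻¹ * CT (fun u => Real.exp (-(u^2)/2)) y := by
    rw [CT, ← integral_const_mul]; congr 1; ext t; rw [gauss]; ring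
  rw [h2] at h
  rw [gauss, ← h]
  have hs : (Real.sqrt (2 * Real.pi))⁻¹ * (Real.sqrt (2 * Real.pi))⁻¹ = (2 * Real.pi)⁻¹ := by
    rw [← mul_inv, Real.mul_self_sqrt (by positivity)]
  have : (Real.sqrt (2 * Real.pi))⁻¹ * (2 * ((Real.sqrt (2 * Real.pi))⁻¹ * CT (fun u => Real.exp (-(u^2)/2)) y))
    = 2 * ((Real.sqrt (2 * Real.pi))⁻¹ * (Real.sqrt (2 * Real.pi))⁻¹) * CT (fun u => Real.exp (-(u^2)/2)) y := by ring
  rw [this, hs]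
  field_simp


lemma int_rpow_st {α a : ℝ} (hα : 0 < α) (ha : -1 < a) :
    IntegrableOn (fun u : ℝ => u ^ a * Real.exp (-(u ^ α))) (Ioi 0) :=
  integrableOn_rpow_mul_exp_neg_rpow ha hα

lemma int_st {α : ℝ} (hα : 0 < α) :
    IntegrableOn (fun u : ℝ => Real.exp (-(u ^ α))) (Ioi 0) := by
  have := int_rpow_st hα (a := 0) (by norm_num)
  simpa using this

lemma int_log_st {α : ℝ} (hα : 0 < α) :
    IntegrableOn (fun u : ℝ => u ^ α * Real.log u * Real.exp (-(u ^ α))) (Ioi 0) := by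
  have h1 := ((int_rpow_st hα (a := α + α) (by linarith)).add (int_st hα)).const_mul (1/α)
  refine h1.mono' ?_ ?_
  · refine ContinuousOn.aestronglyMeasurable ?_ measurableSet_Ioi
    intro u hu
    refine ContinuousAt.continuousWithinAt ?_
    have hc : ContinuousAt (fun u : ℝ => u ^ α) u :=
      Real.continuousAt_rpow_const u α (Or.inl (ne_of_gt hu))
    exact (hc.mul (Real.continuousAt_log (ne_of_gt hu))).mul (Real.continuous_exp.continuousAt.comp hc.neg)
  · refine (ae_restrict_iff' measurableSet_Ioi).2 (Eventually.of_forall fun u (hu : 0 < u) => ?_)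
    have hx : 0 < u ^ α := Real.rpow_pos_of_pos hu α
    simp only [Pi.add_apply, norm_mul, Real.norm_eq_abs]
    rw [abs_of_pos hx, abs_of_pos (Real.exp_pos _), Real.rpow_add hu]
    have hl : |Real.log u| ≤ u ^ α / α + u ^ (-α) / α := by
      have a1 := Real.log_le_rpow_div hu.le hα
      have a2 := Real.log_le_rpow_div (x := u⁻¹) (by positivity) hα
      rw [Real.log_inv, Real.inv_rpow hu.le, ← Real.rpow_neg hu.le] at a2
      have a3 : 0 ≤ u ^ α / α := by positivity
      have a4 : 0 ≤ u ^ (-α) / α := div_nonneg (Real.rpow_nonneg hu.le _) hα.le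
      rw [abs_le]; constructor <;> linarith
    have hi : u ^ α * u ^ (-α) = 1 := by rw [← Real.rpow_add hu]; simp
    have h2 : u ^ α * |Real.log u| ≤ 1/α * (u ^ α * u ^ α + 1) := by
      calc u ^ α * |Real.log u| ≤ u ^ α * (u ^ α / α + u ^ (-α) / α) := by gcongr
        _ = 1/α * (u ^ α * u ^ α + u ^ α * u ^ (-α)) := by ring
        _ = _ := by rw [hi]
    calc u ^ α * |Real.log u| * Real.exp (-(u^α)) ≤ (1/α * (u ^ α * u ^ α + 1)) * Real.exp (-(u^α)) := by gcongr
      _ = _ := by ring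

lemma cos_mul_abs (z u : ℝ) : Real.cos (z * |u|) = Real.cos (z * u) := by
  rcases abs_choice u with h | h
  · rw [h]
  · rw [h, mul_neg, Real.cos_neg]

lemma stable_eq (α z : ℝ) :
    stableDensity α z = 1 / Real.pi * CT (fun u => Real.exp (-(u ^ α))) z := by
  have h := integral_comp_abs (f := fun u => Real.cos (z * u) * Real.exp (-(u ^ α)))
  simp only [cos_mul_abs] at h
  rw [stableDensity, h, CT]
  have := Real.pi_pos.ne'
  field_simp

lemma stableDalpha_eq (α z : ℝ) : stableDensityDalpha α z =
    -(1 / Real.pi) * CT (fun u => u ^ α * Real.log u * Real.exp (-(u ^ α))) z := by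
  have h := integral_comp_abs (f := fun u => Real.cos (z * u) * u ^ α * Real.log u * Real.exp (-(u ^ α)))
  simp only [cos_mul_abs] at h
  rw [stableDensityDalpha, h, CT]
  have := Real.pi_pos.ne'
  field_simp

lemma Dop_stable_eq {α : ℝ} (hα : 0 < α) (z : ℝ) : Dop (stableDensity α) z =
    1 / Real.pi * CT (fun u => α * (u ^ α * Real.exp (-(u ^ α)))) z := by
  have i0 := int_st hα
  have ia := int_rpow_st hα (a := α) (by linarith)
  have i1 : IntegrableOn (fun u : ℝ => u * Real.exp (-(u ^ α))) (Ioi 0) := by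
    have := int_rpow_st hα (a := 1) (by norm_num)
    simpa using this
  have hd : HasDerivAt (CT (fun u => Real.exp (-(u ^ α))))
      (Complex.I * OT (fun u => u * Real.exp (-(u ^ α))) z).re z := by
    have h := Complex.reCLM.hasFDerivAt.comp_hasDerivAt z (OT_hasDerivAt i0 i1 z)
    refine h.congr_of_eventuallyEq (Eventually.of_forall fun x => ?_)
    simp only [CT_eq_re i0, Function.comp, Complex.reCLM_apply]
  have hd2 : deriv (stableDensity α) z = 1 / Real.pi * (Complex.I * OT (fun u => u * Real.exp (-(u ^ α))) z).re := by
    have e : stableDensity α = fun z => 1 / Real.pi * CT (fun u => Real.exp (-(u ^ α))) z := by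
      ext z; exact stable_eq α z
    rw [e]; exact (hd.const_mul _).deriv
  set G : ℝ → ℝ := fun u => Real.exp (-(u ^ α)) + (-α) * (u ^ α * Real.exp (-(u ^ α))) with hG
  have iG : IntegrableOn G (Ioi 0) := i0.add (ia.const_mul _)
  have hibp : z * Complex.I * OT (fun u => u * Real.exp (-(u ^ α))) z = - OT G z := by
    refine OT_ibp ?_ (by simp) ?_ i1 iG ?_ z
    · refine ContinuousAt.continuousWithinAt ?_
      exact continuousAt_id.mul (Real.continuous_exp.continuousAt.comp
        (Real.continuousAt_rpow_const 0 α (Or.inr hα.le)).neg)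
    · intro u hu
      have := (hasDerivAt_id u).mul
        (Real.hasDerivAt_rpow_const (p := α) (Or.inl (ne_of_gt hu))).neg.exp
      refine this.congr_deriv ?_
      have hu' : u ^ α = u ^ (α - 1) * u := by
        rw [← Real.rpow_add_one (ne_of_gt hu)]; simp
      simp only [hG, id, Pi.neg_apply]
      rw [hu']; ring
    · have h := isLittleO_exp_neg_mul_rpow_atTop (a := 1) one_pos (-(1/α))
      have h3 : Tendsto (fun x : ℝ => x ^ (1/α) * Real.exp (-1 * x)) atTop (𝓝 0) :=
        tendsto_rpow_mul_exp_neg_mul_atTop_nhds_zero (1/α) 1 one_pos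
      have h4 := h3.comp (tendsto_rpow_atTop hα)
      refine h4.congr' ?_
      filter_upwards [eventually_gt_atTop 0] with u hu
      simp only [Function.comp]
      rw [← Real.rpow_mul hu.le, mul_one_div_cancel hα.ne', Real.rpow_one, neg_one_mul]
  rw [Dop, hd2, stable_eq]
  have h5 : z * (Complex.I * OT (fun u => u * Real.exp (-(u ^ α))) z).re = - CT G z := by
    rw [CT_eq_re iG, ← Complex.neg_re, ← hibp, ← Complex.re_ofReal_mul]
    congr 1; ring
  have h6 : CT G z = CT (fun u => Real.exp (-(u ^ α))) z
      - CT (fun u => α * (u ^ α * Real.exp (-(u ^ α)))) z := by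
    rw [hG, CT_add (k' := fun u => (-α) * (u ^ α * Real.exp (-(u ^ α)))) i0 (ia.const_mul _), CT_const_mul, CT_const_mul]; ring
  linear_combination (1/Real.pi) * h5 + (-(1/Real.pi)) * h6

lemma hFun_eq {α : ℝ} (hα : 0 < α) (y : ℝ) {w : ℝ} (hw : 0 < w) :
    hFun α y w = α * w ^ α * Pf α (w ^ α) y := by
  have e : hFun α y w = 1 / Real.pi * ∫ z, gauss (y - w * z) * CT (fun u => α * (u ^ α * Real.exp (-(u ^ α)))) z := by
    rw [hFun, ← integral_const_mul]
    congr 1; ext z; rw [Dop_stable_eq hα]; ring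
  rw [e, gauss_conv_CT ((int_rpow_st hα (by linarith)).const_mul α) y w hw, Pf]
  have : CT (fun u => Real.exp (-(u^2)/2) * (α * ((w * u) ^ α * Real.exp (-((w * u) ^ α))))) y
      = CT (fun u => (α * w ^ α) * kP α (w ^ α) u) y := by
    refine CT_congr (fun u hu => ?_) y
    rw [Real.mul_rpow hw.le hu.le, kP]; ring
  rw [this, CT_const_mul]; ring

lemma kFun_eq {α : ℝ} (hα : 0 < α) (y : ℝ) {w : ℝ} (hw : 0 < w) (hw1 : w ^ α ≤ 1) :
    kFun α y w = - w ^ α * (Real.log w * Pf α (w ^ α) y + Qf α (w ^ α) y) := by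
  have hv : w ^ α ∈ Ioc (0:ℝ) 1 := ⟨Real.rpow_pos_of_pos hw _, hw1⟩
  have e : kFun α y w = -(1 / Real.pi) * ∫ z, gauss (y - w * z) * CT (fun u => u ^ α * Real.log u * Real.exp (-(u ^ α))) z := by
    rw [kFun, ← integral_const_mul]
    congr 1; ext z; rw [stableDalpha_eq]; ring
  rw [e, gauss_conv_CT (int_log_st hα) y w hw, Pf, Qf]
  have : CT (fun u => Real.exp (-(u^2)/2) * ((w * u) ^ α * Real.log (w * u) * Real.exp (-((w * u) ^ α)))) y
      = CT (fun u => (w ^ α * Real.log w) * kP α (w ^ α) u + w ^ α * kQ α (w ^ α) u) y := by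
    refine CT_congr (fun u hu => ?_) y
    rw [Real.mul_rpow hw.le hu.le, kP, kQ, Real.log_mul hw.ne' (ne_of_gt hu)]; ring
  have iP := (EC_kP hα).integrableOn_zero (by norm_num) hv
  have iQ := (EC_kQ hα).integrableOn_zero (by norm_num) hv
  rw [this, CT_add (iP.const_mul _) (iQ.const_mul _), CT_const_mul, CT_const_mul]; ring

lemma fFun_eq {α : ℝ} (hα : 0 < α) (y : ℝ) {w : ℝ} (hw : 0 < w) (hw1 : w ^ α ≤ 1) :
    fFun α y w = gauss y - w ^ α * Rf α (w ^ α) y := by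
  have hv : w ^ α ∈ Ioc (0:ℝ) 1 := ⟨Real.rpow_pos_of_pos hw _, hw1⟩
  have e : fFun α y w = (1 / Real.pi) * ∫ z, gauss (y - w * z) * CT (fun u => Real.exp (-(u ^ α))) z := by
    rw [fFun, ← integral_const_mul]
    congr 1; ext z; rw [stable_eq]; ring
  rw [e, gauss_conv_CT (int_st hα) y w hw, gauss_eq_CT, Rf]
  have : CT (fun u => Real.exp (-(u^2)/2) * (Real.exp (-((w * u) ^ α)))) y
      = CT (fun u => Real.exp (-(u^2)/2) + (-(w ^ α)) * kR α (w ^ α) u) y := by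
    refine CT_congr (fun u hu => ?_) y
    have := hv.1
    rw [Real.mul_rpow hw.le hu.le, kR]; field_simp; ring
  have iR := (EC_kR hα).integrableOn_zero (by norm_num) hv
  have i0 : IntegrableOn (fun u : ℝ => Real.exp (-(u^2)/2)) (Ioi 0) := by
    have := (integrable_exp_neg_mul_sq (b := 1/2) (by norm_num)).integrableOn (s := Ioi (0:ℝ))
    refine this.congr_fun (fun u _ => ?_) measurableSet_Ioi
    simp only; congr 1; ring
  rw [this, CT_add i0 (iR.const_mul _), CT_const_mul]; ring


lemma quot_bound {A1 A2 H1 H2 f F E1 E2 G1 G2 D F0 : ℝ} (hF0 : 0 < F0) (hF : F0 ≤ F) (hf : F / 2 ≤ f)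
    (h1 : |A1 - H1| ≤ E1) (h2 : |A2 - H2| ≤ E2) (hA2 : |A2| ≤ G2) (hH1 : |H1| ≤ G1)
    (hH2 : |H2| ≤ G2) (hD : |f - F| ≤ D) :
    |A1 * A2 / f - H1 * H2 / F| ≤ (E1 * G2 + G1 * E2) * (2 / F0) + G1 * G2 * D * (2 / F0 ^ 2) := by
  have hFp : 0 < F := by linarith
  have hfp : 0 < f := by linarith
  have hE1 : 0 ≤ E1 := (abs_nonneg _).trans h1
  have hE2 : 0 ≤ E2 := (abs_nonneg _).trans h2
  have hG1 : 0 ≤ G1 := (abs_nonneg _).trans hH1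
  have hG2 : 0 ≤ G2 := (abs_nonneg _).trans hH2
  have hD0 : 0 ≤ D := (abs_nonneg _).trans hD
  have e : A1 * A2 / f - H1 * H2 / F = ((A1 - H1) * A2 + H1 * (A2 - H2)) * (1 / f)
      + H1 * H2 * (-(f - F)) * (1 / (f * F)) := by field_simp; ring
  rw [e]
  refine (abs_add_le _ _).trans (add_le_add ?_ ?_)
  · rw [abs_mul]
    refine mul_le_mul ?_ ?_ (abs_nonneg _) (by positivity)
    · refine (abs_add_le _ _).trans (add_le_add ?_ ?_)
      · rw [abs_mul]; exact mul_le_mul h1 hA2 (abs_nonneg _) hE1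
      · rw [abs_mul]; exact mul_le_mul hH1 h2 (abs_nonneg _) hG1
    · rw [abs_of_pos (by positivity), div_le_div_iff₀ hfp hF0]; linarith
  · rw [abs_mul]
    refine mul_le_mul ?_ ?_ (abs_nonneg _) (by positivity)
    · rw [abs_mul, abs_mul, abs_neg]
      exact mul_le_mul (mul_le_mul hH1 hH2 (abs_nonneg _) hG1) hD (abs_nonneg _) (by positivity)
    · rw [abs_of_pos (by positivity), div_le_div_iff₀ (by positivity) (by positivity)]
      nlinarith [mul_le_mul hF hF hF0.le hFp.le, mul_le_mul_of_nonneg_right hf hFp.le]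

lemma PQR_bounds {α : ℝ} (hα : α ∈ Ioo (0:ℝ) 2) : ∃ K, 1 ≤ K ∧ ∀ v ∈ Ioc (0:ℝ) 1,
    (∀ y, |Pf α v y| ≤ K ∧ |Qf α v y| ≤ K ∧ |Rf α v y| ≤ K) ∧
    (∀ y, 1 ≤ |y| →
      |Pf α v y + cAlpha α * |y| ^ (-α-1)| ≤ K * ((|y| ^ (-(1/2):ℝ) + v) * |y| ^ (-α-1)) ∧
      |Qf α v y + (deriv cAlpha α - cAlpha α * Real.log |y|) * |y| ^ (-α-1)|
        ≤ K * ((|y| ^ (-(1/2):ℝ) + v) * |y| ^ (-α-1)) ∧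
      |Rf α v y + cAlpha α * |y| ^ (-α-1)| ≤ K * ((|y| ^ (-(1/2):ℝ) + v) * |y| ^ (-α-1))) := by
  obtain ⟨C1, hC1, h1⟩ := CT_EC_bdd (EC_kP hα.1)
  obtain ⟨C2, hC2, h2⟩ := CT_EC_bdd (EC_kQ hα.1)
  obtain ⟨C3, hC3, h3⟩ := CT_EC_bdd (EC_kR hα.1)
  obtain ⟨C4, hC4, h4⟩ := Pf_asymp hα
  obtain ⟨C5, hC5, h5⟩ := Qf_asymp hα
  obtain ⟨C6, hC6, h6⟩ := Rf_asymp hα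
  refine ⟨1 + C1 + C2 + C3 + C4 + C5 + C6, by linarith, fun v hv => ⟨fun y => ⟨?_, ?_, ?_⟩, fun y hy => ?_⟩⟩
  · exact (h1 v hv y).trans (by linarith)
  · exact (h2 v hv y).trans (by linarith)
  · exact (h3 v hv y).trans (by linarith)
  · have hX : 0 ≤ (|y| ^ (-(1/2):ℝ) + v) * |y| ^ (-α-1) := by
      have := hv.1
      positivity
    have eP : Pf α v y = Pf α v |y| := by rw [Pf, Pf, CT_abs_arg]
    have eQ : Qf α v y = Qf α v |y| := by rw [Qf, Qf, CT_abs_arg]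
    have eR : Rf α v y = Rf α v |y| := by rw [Rf, Rf, CT_abs_arg]
    rw [eP, eQ, eR]
    refine ⟨(h4 v hv _ hy).trans ?_, (h5 v hv _ hy).trans ?_, (h6 v hv _ hy).trans ?_⟩ <;>
    exact mul_le_mul_of_nonneg_right (by linarith) hX

lemma tail_set (g : ℝ) (hg : 0 < g) : {y : ℝ | g < |y|} = Ioi g ∪ Iio (-g) := by
  ext y; simp only [mem_ofPred_eq, mem_union, mem_Ioi, mem_Iio, lt_abs]
  constructor <;> rintro (h | h)
  · left; exact h
  · right; linarith
  · left; exact h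
  · right; linarith

lemma tail_integrable {φ : ℝ → ℝ} {g : ℝ} (hg : 0 < g) (h : IntegrableOn φ (Ioi g)) :
    IntegrableOn (fun y => φ |y|) {y : ℝ | g < |y|} ∧
      ∫ y in {y : ℝ | g < |y|}, φ |y| = 2 * ∫ t in Ioi g, φ t := by
  have h1 : IntegrableOn (fun y => φ |y|) (Ioi g) := by
    refine h.congr_fun (fun y hy => ?_) measurableSet_Ioi
    rw [abs_of_pos (hg.trans hy)]
  have h2 : IntegrableOn (fun y => φ |y|) (Iio (-g)) := by
    rw [← Measure.map_neg_eq_self (volume : Measure ℝ)]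
    let m : MeasurableEmbedding fun x : ℝ => -x := (Homeomorph.neg ℝ).measurableEmbedding
    rw [m.integrableOn_map_iff]
    simp_rw [Function.comp_def, abs_neg, neg_preimage, neg_Iio, neg_neg]
    exact h1
  have hd : Disjoint (Ioi g) (Iio (-g)) := by
    rw [Set.disjoint_left]; intro y hy hy'
    simp only [mem_Ioi, mem_Iio] at hy hy'; linarith
  rw [tail_set g hg]
  refine ⟨h1.union h2, ?_⟩
  rw [setIntegral_union hd measurableSet_Iio h1 h2]
  have e1 : ∫ y in Ioi g, φ |y| = ∫ t in Ioi g, φ t :=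
    setIntegral_congr_fun measurableSet_Ioi fun y hy => by
      rw [abs_of_pos (hg.trans hy)]
  have e2 : ∫ y in Iio (-g), φ |y| = ∫ t in Ioi g, φ t := by
    rw [← integral_Iic_eq_integral_Iio]
    have := integral_comp_neg_Iic (-g) φ
    rw [neg_neg] at this
    rw [← this]
    refine setIntegral_congr_fun measurableSet_Iic fun y hy => ?_
    have : y ≤ -g := hy
    rw [abs_of_neg (by linarith)]
  rw [e1, e2]; ring

/-- The tail majorant and its integral. -/
lemma tail_major {α g : ℝ} (hα : 0 < α) (hg : 0 < g) :
    IntegrableOn (fun y => |y| ^ (-α-1) * (|y| / g) ^ (α/2)) {y : ℝ | g < |y|} ∧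
    ∫ y in {y : ℝ | g < |y|}, |y| ^ (-α-1) * (|y| / g) ^ (α/2) = 4 / α * g ^ (-α) := by
  have e : ∀ t ∈ Ioi g, t ^ (-α-1) * (t / g) ^ (α/2) = g ^ (-(α/2)) * t ^ (-(α/2) - 1) := by
    intro t ht
    have ht0 : 0 < t := hg.trans ht
    rw [Real.div_rpow ht0.le hg.le, Real.rpow_neg hg.le, show -(α/2) - 1 = (-α - 1) + α/2 by ring,
      Real.rpow_add ht0]
    ring
  have i0 : IntegrableOn (fun t : ℝ => g ^ (-(α/2)) * t ^ (-(α/2) - 1)) (Ioi g) :=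
    (integrableOn_Ioi_rpow_of_lt (by linarith) hg).const_mul _
  have i1 : IntegrableOn (fun t : ℝ => t ^ (-α-1) * (t / g) ^ (α/2)) (Ioi g) :=
    i0.congr_fun (fun t ht => (e t ht).symm) measurableSet_Ioi
  obtain ⟨h1, h2⟩ := tail_integrable hg i1
  refine ⟨h1, ?_⟩
  rw [h2, setIntegral_congr_fun measurableSet_Ioi e, integral_const_mul,
    integral_Ioi_rpow_of_lt (by linarith) hg]
  rw [sub_add_cancel, show -α = -(α/2) + -(α/2) by ring, Real.rpow_add hg]
  field_simp
  ring

lemma gauss_anti {y g : ℝ} (h : |y| ≤ g) : gauss g ≤ gauss y := by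
  unfold gauss
  have : y ^ 2 ≤ g ^ 2 := sq_le_sq' (by linarith [neg_abs_le y]) ((le_abs_self y).trans h)
  gcongr

lemma g_large (M : ℝ) : ∀ᶠ g : ℝ in atTop, M * (g ^ 4 * Real.exp (-(g^2)/2)) ≤ 1 := by
  have h := (Real.tendsto_pow_mul_exp_neg_atTop_nhds_zero 4).const_mul |M|
  rw [mul_zero] at h
  filter_upwards [h.eventually_le_const one_pos, eventually_ge_atTop 2] with g hg h2
  refine le_trans ?_ hg
  have : Real.exp (-(g^2)/2) ≤ Real.exp (-g) := Real.exp_le_exp.2 (by nlinarith)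
  have h3 : 0 ≤ g ^ 4 * Real.exp (-(g^2)/2) := by positivity
  calc M * (g ^ 4 * Real.exp (-(g^2)/2)) ≤ |M| * (g ^ 4 * Real.exp (-(g^2)/2)) :=
        mul_le_mul_of_nonneg_right (le_abs_self M) h3
    _ ≤ _ := by gcongr


/-- Main term of the linear combination `p P + q Q`. -/
def Hm (α p q y : ℝ) : ℝ :=
  ((-(p * cAlpha α) - q * deriv cAlpha α) + q * (cAlpha α * Real.log |y|)) * |y| ^ (-α-1)

lemma comb_err {c d K e Y L P Q p q m : ℝ} (hKe : 0 ≤ K * (e * Y)) (hp : |p| ≤ m) (hq : |q| ≤ m)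
    (hP : |P + c * Y| ≤ K * (e * Y)) (hQ : |Q + (d - c * L) * Y| ≤ K * (e * Y)) :
    |(p * P + q * Q) - ((-(p * c) - q * d) + q * (c * L)) * Y| ≤ 2 * K * m * (e * Y) := by
  have : (p * P + q * Q) - ((-(p * c) - q * d) + q * (c * L)) * Y
      = p * (P + c * Y) + q * (Q + (d - c * L) * Y) := by ring
  rw [this]
  refine (abs_add_le _ _).trans ?_
  rw [abs_mul, abs_mul]
  have hm : 0 ≤ m := (abs_nonneg p).trans hp
  have h1 := mul_le_mul hp hP (abs_nonneg _) hm
  have h2 := mul_le_mul hq hQ (abs_nonneg _) hm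
  nlinarith

lemma comb_main {c d Y L p q m lg a t : ℝ} (hc : 0 < c) (hY : 0 ≤ Y) (hp : |p| ≤ m)
    (hlg : 0 ≤ lg) (hq : |q| * (1 + lg) ≤ m) (ha : 0 ≤ a) (ht : 1 ≤ t) (hL0 : 0 ≤ L)
    (hL : L ≤ lg + a * t) :
    |((-(p * c) - q * d) + q * (c * L)) * Y| ≤ (2 * c + |d| + c * a) * m * (t * Y) := by
  have hq0 : 0 ≤ |q| := abs_nonneg q
  have hq1 : |q| ≤ m := by nlinarith
  have hq2 : |q| * lg ≤ m := by nlinarith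
  have hm : 0 ≤ m := hq0.trans hq1
  rw [abs_mul, abs_of_nonneg hY, ← mul_assoc (_ * m) t Y]
  refine mul_le_mul_of_nonneg_right ?_ hY
  have h1 : |(-(p * c) - q * d) + q * (c * L)| ≤ |p| * c + |q| * |d| + |q| * (c * L) := by
    refine (abs_add_le _ _).trans (add_le_add ((abs_sub _ _).trans ?_) ?_)
    · rw [abs_neg, abs_mul, abs_mul, abs_of_pos hc]
    · rw [abs_mul, abs_of_nonneg (by positivity : 0 ≤ c * L)]
  refine h1.trans ?_
  have h2 : |p| * c ≤ m * c := by gcongr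
  have h3 : |q| * |d| ≤ m * |d| := by gcongr
  have h4 : |q| * (c * L) ≤ c * (m + m * (a * t)) := by
    calc |q| * (c * L) ≤ |q| * (c * (lg + a * t)) := by gcongr
      _ = c * (|q| * lg + |q| * (a * t)) := by ring
      _ ≤ c * (m + m * (a * t)) := by
        have : |q| * (a * t) ≤ m * (a * t) := by gcongr
        gcongr
  have h5 : (2 * c + |d|) * m ≤ (2 * c + |d|) * m * t := le_mul_of_one_le_right (by positivity) ht
  nlinarith

set_option maxHeartbeats 1000000 in
lemma tail_pt {c d K e Y L P Q R lg a t v G p1 q1 m1 p2 q2 m2 : ℝ} (hc : 0 < c) (hY : 0 < Y)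
    (hK : 0 < K) (he : 0 ≤ e) (hKe : 2 * K * e ≤ c) (hv : 0 < v) (hG : 0 ≤ G)
    (hlg : 0 ≤ lg) (ha : 0 ≤ a) (ht : 1 ≤ t) (hL0 : 0 ≤ L) (hL : L ≤ lg + a * t)
    (hp1 : |p1| ≤ m1) (hq1 : |q1| * (1 + lg) ≤ m1)
    (hp2 : |p2| ≤ m2) (hq2 : |q2| * (1 + lg) ≤ m2)
    (hP : |P + c * Y| ≤ K * (e * Y)) (hQ : |Q + (d - c * L) * Y| ≤ K * (e * Y))
    (hR : |R + c * Y| ≤ K * (e * Y)) {K3 : ℝ} (hK3 : K3 = 2 * K + c + (2 * c + |d| + c * a)) :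
    |(v * (p1 * P + q1 * Q)) * (v * (p2 * P + q2 * Q)) / (G - v * R)
      - (v * (((-(p1 * c) - q1 * d) + q1 * (c * L)) * Y))
        * (v * (((-(p2 * c) - q2 * d) + q2 * (c * L)) * Y)) / (G + c * v * Y)|
      ≤ (4 * K3 ^ 2 / c + 2 * K3 ^ 3 / c ^ 2) * (m1 * m2) * e * v * (Y * t ^ 2) ∧
    |(v * (((-(p1 * c) - q1 * d) + q1 * (c * L)) * Y))
        * (v * (((-(p2 * c) - q2 * d) + q2 * (c * L)) * Y)) / (G + c * v * Y)|
      ≤ K3 ^ 2 / c * (m1 * m2) * v * (Y * t ^ 2) := by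
  have ht0 : 0 < t := by linarith
  have hK3p : 0 < K3 := by rw [hK3]; positivity
  have hm1 : 0 ≤ m1 := (abs_nonneg _).trans hp1
  have hm2 : 0 ≤ m2 := (abs_nonneg _).trans hp2
  have hq1' : |q1| ≤ m1 := by nlinarith [abs_nonneg q1]
  have hq2' : |q2| ≤ m2 := by nlinarith [abs_nonneg q2]
  have hKeY : 0 ≤ K * (e * Y) := by positivity
  have e1 := comb_err hKeY hp1 hq1' hP hQ
  have e2 := comb_err hKeY hp2 hq2' hP hQ
  have b1 := comb_main (d := d) hc hY.le hp1 hlg hq1 ha ht hL0 hL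
  have b2 := comb_main (d := d) hc hY.le hp2 hlg hq2 ha ht hL0 hL
  set H1 := ((-(p1 * c) - q1 * d) + q1 * (c * L)) * Y
  set H2 := ((-(p2 * c) - q2 * d) + q2 * (c * L)) * Y
  set A1 := p1 * P + q1 * Q
  set A2 := p2 * P + q2 * Q
  set K2 := 2 * c + |d| + c * a with hK2
  have hK2p : 0 ≤ K2 := by positivity
  have E1 : |v * A1 - v * H1| ≤ v * (K3 * m1 * (e * Y)) := by
    rw [← mul_sub, abs_mul, abs_of_pos hv]
    have : 2 * K * m1 * (e * Y) ≤ K3 * m1 * (e * Y) := by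
      have : 2 * K ≤ K3 := by rw [hK3]; linarith
      gcongr
    exact mul_le_mul_of_nonneg_left (e1.trans this) hv.le
  have E2 : |v * A2 - v * H2| ≤ v * (K3 * m2 * (e * Y)) := by
    rw [← mul_sub, abs_mul, abs_of_pos hv]
    have : 2 * K * m2 * (e * Y) ≤ K3 * m2 * (e * Y) := by
      have : 2 * K ≤ K3 := by rw [hK3]; linarith
      gcongr
    exact mul_le_mul_of_nonneg_left (e2.trans this) hv.le
  have hK23 : K2 ≤ K3 := by rw [hK3]; linarith
  have G1 : |v * H1| ≤ v * (K3 * m1 * (t * Y)) := by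
    rw [abs_mul, abs_of_pos hv]
    refine mul_le_mul_of_nonneg_left (b1.trans ?_) hv.le
    gcongr
  have G2 : |v * H2| ≤ v * (K3 * m2 * (t * Y)) := by
    rw [abs_mul, abs_of_pos hv]
    refine mul_le_mul_of_nonneg_left (b2.trans ?_) hv.le
    gcongr
  have GA2 : |v * A2| ≤ v * (K3 * m2 * (t * Y)) := by
    rw [abs_mul, abs_of_pos hv]
    refine mul_le_mul_of_nonneg_left ?_ hv.le
    have h0 : |A2| ≤ |A2 - H2| + |H2| := by
      have := abs_add_le (A2 - H2) H2
      rwa [sub_add_cancel] at this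
    have h1 : 2 * K * m2 * (e * Y) ≤ c * m2 * (t * Y) := by
      calc 2 * K * m2 * (e * Y) = (2 * K * e) * (m2 * Y) := by ring
        _ ≤ c * (m2 * Y) := by gcongr
        _ ≤ c * (m2 * Y) * t := le_mul_of_one_le_right (by positivity) ht
        _ = _ := by ring
    calc |A2| ≤ c * m2 * (t * Y) + K2 * m2 * (t * Y) := h0.trans (add_le_add (e2.trans h1) b2)
      _ = (c + K2) * m2 * (t * Y) := by ring
      _ ≤ K3 * m2 * (t * Y) := by
        have : c + K2 ≤ K3 := by rw [hK3]; linarith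
        gcongr
  have hF0 : 0 < c * v * Y := by positivity
  have hF : c * v * Y ≤ G + c * v * Y := by linarith
  have hD : |(G - v * R) - (G + c * v * Y)| ≤ v * (K * (e * Y)) := by
    have : (G - v * R) - (G + c * v * Y) = - (v * (R + c * Y)) := by ring
    rw [this, abs_neg, abs_mul, abs_of_pos hv]
    exact mul_le_mul_of_nonneg_left hR hv.le
  have hD' : |(G - v * R) - (G + c * v * Y)| ≤ v * (K3 * (e * Y)) := by
    refine hD.trans ?_
    have : K ≤ K3 := by rw [hK3]; linarith
    gcongr
  have hf : (G + c * v * Y) / 2 ≤ G - v * R := by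
    have h1 : v * (K * (e * Y)) ≤ c * v * Y / 2 := by
      have : (2 * K * e) * (v * Y) ≤ c * (v * Y) := by gcongr
      linarith
    have := (abs_le.1 (hD.trans h1)).1
    linarith
  constructor
  · refine (quot_bound hF0 hF hf E1 E2 GA2 G1 G2 hD').trans ?_
    have : (v * (K3 * m1 * (e * Y)) * (v * (K3 * m2 * (t * Y)))
        + v * (K3 * m1 * (t * Y)) * (v * (K3 * m2 * (e * Y)))) * (2 / (c * v * Y))
        + v * (K3 * m1 * (t * Y)) * (v * (K3 * m2 * (t * Y))) * (v * (K3 * (e * Y)))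
          * (2 / (c * v * Y) ^ 2)
        = (4 * K3 ^ 2 / c * t + 2 * K3 ^ 3 / c ^ 2 * t ^ 2) * ((m1 * m2) * e * v * Y) := by
      field_simp
      ring
    rw [this]
    have h2 : 4 * K3 ^ 2 / c * t + 2 * K3 ^ 3 / c ^ 2 * t ^ 2
        ≤ (4 * K3 ^ 2 / c + 2 * K3 ^ 3 / c ^ 2) * t ^ 2 := by
      have : t ≤ t ^ 2 := le_self_pow₀ ht two_ne_zero
      have : 4 * K3 ^ 2 / c * t ≤ 4 * K3 ^ 2 / c * t ^ 2 := by gcongr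
      linarith
    calc _ ≤ ((4 * K3 ^ 2 / c + 2 * K3 ^ 3 / c ^ 2) * t ^ 2) * ((m1 * m2) * e * v * Y) := by
          gcongr
      _ = _ := by ring
  · rw [abs_div, abs_mul, abs_of_pos (hF0.trans_le hF)]
    calc |v * H1| * |v * H2| / (G + c * v * Y)
        ≤ (v * (K3 * m1 * (t * Y))) * (v * (K3 * m2 * (t * Y))) / (c * v * Y) := by
          gcongr
      _ = _ := by field_simp

lemma inner_pt {K v G g0 P Q R p1 q1 m1 p2 q2 m2 : ℝ} (hK : 0 < K) (hv : 0 < v) (hg0 : 0 < g0)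
    (hG : g0 ≤ G) (hvK : v * K ≤ g0 / 2)
    (hp1 : |p1| ≤ m1) (hq1 : |q1| ≤ m1) (hp2 : |p2| ≤ m2) (hq2 : |q2| ≤ m2)
    (hP : |P| ≤ K) (hQ : |Q| ≤ K) (hR : |R| ≤ K) :
    |(v * (p1 * P + q1 * Q)) * (v * (p2 * P + q2 * Q)) / (G - v * R)|
      ≤ 8 * K ^ 2 * (m1 * m2) * (v ^ 2 / g0) := by
  have hm1 : 0 ≤ m1 := (abs_nonneg _).trans hp1
  have hm2 : 0 ≤ m2 := (abs_nonneg _).trans hp2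
  have key : ∀ p q m : ℝ, |p| ≤ m → |q| ≤ m → |v * (p * P + q * Q)| ≤ v * (2 * K * m) := by
    intro p q m hp hq
    rw [abs_mul, abs_of_pos hv]
    refine mul_le_mul_of_nonneg_left ?_ hv.le
    refine (abs_add_le _ _).trans ?_
    rw [abs_mul, abs_mul]
    have hm : 0 ≤ m := (abs_nonneg _).trans hp
    have h1 := mul_le_mul hp hP (abs_nonneg _) hm
    have h2 := mul_le_mul hq hQ (abs_nonneg _) hm
    linarith
  have hf : g0 / 2 ≤ G - v * R := by
    have : v * R ≤ v * K := mul_le_mul_of_nonneg_left ((le_abs_self R).trans hR) hv.le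
    linarith
  rw [abs_div, abs_mul, abs_of_pos (show 0 < G - v * R by linarith)]
  calc _ ≤ (v * (2 * K * m1)) * (v * (2 * K * m2)) / (g0 / 2) := by
        have := key p1 q1 m1 hp1 hq1
        have := key p2 q2 m2 hp2 hq2
        gcongr
    _ = _ := by field_simp; ring

lemma Pf_continuous {α v : ℝ} (hα : 0 < α) (hv : v ∈ Ioc (0:ℝ) 1) : Continuous (Pf α v) :=
  continuous_const.mul (CT_continuous ((EC_kP hα).integrableOn_zero (by norm_num) hv))
lemma Qf_continuous {α v : ℝ} (hα : 0 < α) (hv : v ∈ Ioc (0:ℝ) 1) : Continuous (Qf α v) :=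
  continuous_const.mul (CT_continuous ((EC_kQ hα).integrableOn_zero (by norm_num) hv))
lemma Rf_continuous {α v : ℝ} (hα : 0 < α) (hv : v ∈ Ioc (0:ℝ) 1) : Continuous (Rf α v) :=
  continuous_const.mul (CT_continuous ((EC_kR hα).integrableOn_zero (by norm_num) hv))

/-- abstract comparison of integrals -/
lemma split_compare {Φ Ψ M : ℝ → ℝ} {g a b B : ℝ} (hg : 0 < g) (hΦ : Measurable Φ) (hΨ : Measurable Ψ)
    (hM : IntegrableOn M {y : ℝ | g < |y|}) (hB : 0 ≤ B)
    (h1 : ∀ y, |y| ≤ g → |Φ y| ≤ B)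
    (h2 : ∀ y, g < |y| → |Φ y - Ψ y| ≤ a * M y)
    (h3 : ∀ y, g < |y| → |Ψ y| ≤ b * M y) :
    IntegrableOn Ψ {y : ℝ | g < |y|} ∧
    |(∫ y, Φ y) - ∫ y in {y : ℝ | g < |y|}, Ψ y| ≤ B * (2 * g) + a * ∫ y in {y : ℝ | g < |y|}, M y := by
  have hS : MeasurableSet {y : ℝ | g < |y|} := by
    rw [tail_set g hg]; exact measurableSet_Ioi.union measurableSet_Iio
  have hSc : {y : ℝ | g < |y|}ᶜ = Icc (-g) g := by
    ext y; simp only [mem_compl_iff, mem_ofPred_eq, not_lt, mem_Icc, abs_le]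
  set S := {y : ℝ | g < |y|} with hSdef
  have iΨ : IntegrableOn Ψ S := by
    refine Integrable.mono' (hM.const_mul b) hΨ.aestronglyMeasurable ?_
    exact (ae_restrict_iff' hS).2 (ae_of_all _ fun y hy => h3 y hy)
  have iD : IntegrableOn (fun y => Φ y - Ψ y) S := by
    refine Integrable.mono' (hM.const_mul a) (hΦ.sub hΨ).aestronglyMeasurable ?_
    exact (ae_restrict_iff' hS).2 (ae_of_all _ fun y hy => h2 y hy)
  have iΦ : IntegrableOn Φ S := by
    have := iD.add iΨ
    refine this.congr_fun (fun y _ => ?_) hS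
    simp
  have hbd : ∀ y ∈ Icc (-g) g, ‖Φ y‖ ≤ B := fun y hy => h1 y (abs_le.2 hy)
  have iΦc : IntegrableOn Φ (Icc (-g) g) := by
    refine Measure.integrableOn_of_bounded (M := B) (by simp) hΦ.aestronglyMeasurable ?_
    exact (ae_restrict_iff' measurableSet_Icc).2 (ae_of_all _ hbd)
  have iAll : Integrable Φ := by
    have := iΦ.union (hSc ▸ iΦc)
    rwa [union_compl_self, integrableOn_univ] at this
  refine ⟨iΨ, ?_⟩
  have e : (∫ y, Φ y) - ∫ y in S, Ψ y = (∫ y in Icc (-g) g, Φ y) + ∫ y in S, (Φ y - Ψ y) := by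
    rw [← integral_add_compl hS iAll, hSc, integral_sub iΦ iΨ]; ring
  rw [e]
  refine (abs_add_le _ _).trans (add_le_add ?_ ?_)
  · have := norm_setIntegral_le_of_norm_le_const (μ := volume) (s := Icc (-g) g) (f := Φ) (C := B)
      (by simp) hbd
    rw [Real.norm_eq_abs] at this
    refine this.trans (le_of_eq ?_)
    rw [measureReal_def, Real.volume_Icc, ENNReal.toReal_ofReal (by linarith)]; ring
  · have : ‖∫ y in S, (Φ y - Ψ y)‖ ≤ ∫ y in S, a * M y :=
      norm_integral_le_of_norm_le (hM.const_mul a)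
        ((ae_restrict_iff' hS).2 (ae_of_all _ fun y hy => h2 y hy))
    rw [integral_const_mul] at this
    exact this


lemma g_conditions {κ K c : ℝ} (hκ : 0 < κ) (hK : 1 ≤ K) (hc : 0 < c) {α : ℝ} (hα : α ∈ Ioo (0:ℝ) 2) :
    ∃ g0 : ℝ, 3 ≤ g0 ∧ ∀ g ≥ g0, κ * Real.exp (-(g^2)) ≤ 1 ∧
      κ * Real.exp (-(g^2)) ≤ g ^ (-(1/2):ℝ) ∧ κ * Real.exp (-(g^2)) * K ≤ gauss g / 2 ∧
      (κ * Real.exp (-(g^2))) ^ 2 / gauss g * g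
        ≤ g ^ (-(1/2):ℝ) * (κ * Real.exp (-(g^2)) * g ^ (-α)) ∧
      4 * K * g ^ (-(1/2):ℝ) ≤ c := by
  set s := Real.sqrt (2 * Real.pi) with hs
  have hs0 : 0 < s := by rw [hs]; positivity
  have hK0 : 0 < K := by linarith
  have hlim : Tendsto (fun g : ℝ => 4 * K * g ^ (-(1/2):ℝ)) atTop (𝓝 0) := by
    have := (tendsto_rpow_neg_atTop (show (0:ℝ) < 1/2 by norm_num)).const_mul (4 * K)
    rwa [mul_zero] at this
  have hev : ∀ᶠ g : ℝ in atTop, κ * Real.exp (-(g^2)) ≤ 1 ∧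
      κ * Real.exp (-(g^2)) ≤ g ^ (-(1/2):ℝ) ∧ κ * Real.exp (-(g^2)) * K ≤ gauss g / 2 ∧
      (κ * Real.exp (-(g^2))) ^ 2 / gauss g * g
        ≤ g ^ (-(1/2):ℝ) * (κ * Real.exp (-(g^2)) * g ^ (-α)) ∧
      4 * K * g ^ (-(1/2):ℝ) ≤ c := by
    filter_upwards [g_large κ, g_large (κ * s * (2 * K + 1)), eventually_ge_atTop 3,
      hlim.eventually_le_const hc] with g h1 h2 h3 h4
    have hg0 : 0 < g := by linarith
    have hg1 : 1 ≤ g := by linarith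
    have hx2 : Real.exp (-(g^2)) = Real.exp (-(g^2)/2) * Real.exp (-(g^2)/2) := by
      rw [← Real.exp_add]; congr 1; ring
    have hgs : gauss g = Real.exp (-(g^2)/2) / s := by
      rw [gauss, ← hs]; ring
    have hx1 : Real.exp (-(g^2)/2) ≤ 1 := by
      rw [Real.exp_le_one_iff]; nlinarith
    have hx0 : 0 < Real.exp (-(g^2)/2) := Real.exp_pos _
    rw [hx2, hgs]
    set x := Real.exp (-(g^2)/2)
    have hgp : 1 ≤ g ^ 4 := one_le_pow₀ hg1
    have hκx : κ * x ≤ 1 := by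
      refine le_trans ?_ h1
      have : κ * x ≤ κ * x * g ^ 4 := le_mul_of_one_le_right (by positivity) hgp
      linarith
    have hpow : ∀ r : ℝ, r ≤ 4 → g ^ r ≤ g ^ 4 := by
      intro r hr
      rw [← Real.rpow_natCast g 4]
      exact Real.rpow_le_rpow_of_exponent_le hg1 (by norm_num; exact hr)
    refine ⟨?_, ?_, ?_, ?_, h4⟩
    · calc κ * (x * x) = (κ * x) * x := by ring
        _ ≤ 1 * 1 := mul_le_mul hκx hx1 hx0.le zero_le_one
        _ = 1 := one_mul 1
    · rw [Real.rpow_neg hg0.le, ← one_div, le_div_iff₀ (Real.rpow_pos_of_pos hg0 _)]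
      calc κ * (x * x) * g ^ (1/2:ℝ) ≤ κ * (x * 1) * g ^ 4 := by
            have := hpow (1/2) (by norm_num)
            gcongr
        _ = κ * (g ^ 4 * x) := by ring
        _ ≤ 1 := h1
    · have h5 : κ * s * (2 * K) * x ≤ 1 := by
        refine le_trans ?_ h2
        have : κ * s * (2 * K) * x ≤ κ * s * (2 * K + 1) * x := by gcongr; linarith
        have h6 : κ * s * (2 * K + 1) * x ≤ κ * s * (2 * K + 1) * x * g ^ 4 :=
          le_mul_of_one_le_right (by positivity) hgp
        linarith
      rw [div_div, le_div_iff₀ (by positivity)]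
      calc κ * (x * x) * K * (s * 2) = (κ * s * (2 * K) * x) * x := by ring
        _ ≤ 1 * x := by gcongr
        _ = x := one_mul x
    · have h5 : κ * s * x * (g * g ^ (1/2:ℝ) * g ^ α) ≤ 1 := by
        have e : g * g ^ (1/2:ℝ) * g ^ α = g ^ (1 + 1/2 + α) := by
          rw [Real.rpow_add hg0, Real.rpow_add hg0, Real.rpow_one]
        rw [e]
        refine le_trans ?_ h2
        have := hpow (1 + 1/2 + α) (by linarith [hα.2])
        calc κ * s * x * g ^ (1 + 1/2 + α) ≤ κ * s * x * g ^ 4 := by gcongr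
          _ ≤ κ * s * x * g ^ 4 * (2 * K + 1) := le_mul_of_one_le_right (by positivity) (by linarith)
          _ = _ := by ring
      rw [Real.rpow_neg hg0.le, Real.rpow_neg hg0.le]
      have p1 : 0 < g ^ (1/2:ℝ) := Real.rpow_pos_of_pos hg0 _
      have p2 : 0 < g ^ α := Real.rpow_pos_of_pos hg0 _
      calc (κ * (x * x)) ^ 2 / (x / s) * g
          = (κ * (x * x)) * (κ * s * x * (g * g ^ (1/2:ℝ) * g ^ α)) * ((g ^ (1/2:ℝ))⁻¹ * (g ^ α)⁻¹) := by
            field_simp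
        _ ≤ (κ * (x * x)) * 1 * ((g ^ (1/2:ℝ))⁻¹ * (g ^ α)⁻¹) := by gcongr
        _ = _ := by ring
  obtain ⟨g0, h⟩ := eventually_atTop.1 hev
  exact ⟨max g0 3, le_max_right _ _, fun g hg => h g ((le_max_left _ _).trans hg)⟩

lemma log_tail {α g t : ℝ} (hα : 0 < α) (hg : 0 < g) (ht : 0 < t) :
    Real.log t ≤ Real.log g + 4 / α * (t / g) ^ (α/4) := by
  have h := Real.log_le_rpow_div (x := t / g) (by positivity) (show 0 < α/4 by positivity)
  rw [Real.log_div ht.ne' hg.ne'] at h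
  have : (t / g) ^ (α/4) / (α/4) = 4 / α * (t / g) ^ (α/4) := by field_simp
  linarith

set_option maxHeartbeats 1000000 in
lemma main_lemma {α κ : ℝ} (hα : α ∈ Ioo (0:ℝ) 2) (hκ : 0 < κ) :
    ∃ C > 0, ∃ g0 : ℝ, 3 ≤ g0 ∧ ∀ g ≥ g0, ∀ v, v = κ * Real.exp (-(g^2)) → v ≤ 1 ∧
      ∀ p1 q1 m1 p2 q2 m2 : ℝ, |p1| ≤ m1 → |q1| * (1 + Real.log g) ≤ m1 →
        |p2| ≤ m2 → |q2| * (1 + Real.log g) ≤ m2 →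
        IntegrableOn (fun y => (v * Hm α p1 q1 y) * (v * Hm α p2 q2 y)
          / (gauss y + cAlpha α * v * |y| ^ (-α-1))) {y : ℝ | g < |y|} ∧
        |(∫ y, (v * (p1 * Pf α v y + q1 * Qf α v y)) * (v * (p2 * Pf α v y + q2 * Qf α v y))
            / (gauss y - v * Rf α v y))
          - ∫ y in {y : ℝ | g < |y|}, (v * Hm α p1 q1 y) * (v * Hm α p2 q2 y)
            / (gauss y + cAlpha α * v * |y| ^ (-α-1))|
          ≤ C * (m1 * m2) * (g ^ (-(1/2):ℝ) * (v * g ^ (-α))) := by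
  obtain ⟨K, hK, hb⟩ := PQR_bounds hα
  have hc := cAlpha_pos hα
  obtain ⟨g0, hg03, hcond⟩ := g_conditions hκ hK hc hα
  have hα0 : 0 < α := hα.1
  have hK0 : 0 < K := by linarith
  set c := cAlpha α with hcdef
  set d := deriv cAlpha α with hd
  set K3 := 2 * K + c + (2 * c + |d| + c * (4 / α)) with hK3
  have hK3p : 0 < K3 := by positivity
  set C3 := 4 * K3 ^ 2 / c + 2 * K3 ^ 3 / c ^ 2 with hC3
  have hC3p : 0 < C3 := by positivity
  refine ⟨16 * K ^ 2 + C3 * 2 * (4 / α), by positivity, g0, hg03, fun g hg v hv => ?_⟩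
  obtain ⟨hv1, hv2, hv3, hv4, hv5⟩ := hcond g hg
  rw [← hv] at hv1 hv2 hv3 hv4
  have hv0 : 0 < v := by rw [hv]; positivity
  refine ⟨hv1, ?_⟩
  intro p1 q1 m1 p2 q2 m2 hp1 hq1 hp2 hq2
  have hg3 : 3 ≤ g := hg03.trans hg
  have hg0 : 0 < g := by linarith
  have hlg : 0 ≤ Real.log g := Real.log_nonneg (by linarith)
  have hm1 : 0 ≤ m1 := (abs_nonneg _).trans hp1
  have hm2 : 0 ≤ m2 := (abs_nonneg _).trans hp2
  have hq1' : |q1| ≤ m1 := by nlinarith [abs_nonneg q1]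
  have hq2' : |q2| ≤ m2 := by nlinarith [abs_nonneg q2]
  obtain ⟨hb1, hb2⟩ := hb v ⟨hv0, hv1⟩
  have cP := Pf_continuous hα0 (v := v) ⟨hv0, hv1⟩
  have cQ := Qf_continuous hα0 (v := v) ⟨hv0, hv1⟩
  have cR := Rf_continuous hα0 (v := v) ⟨hv0, hv1⟩
  have hgm : Measurable gauss := gauss_continuous.measurable
  have mP := cP.measurable
  have mQ := cQ.measurable
  have mR := cR.measurable
  have mabs : Measurable fun y : ℝ => |y| := continuous_abs.measurable
  have mH : ∀ p q, Measurable (Hm α p q) := by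
    intro p q
    unfold Hm
    exact (measurable_const.add (measurable_const.mul (measurable_const.mul
      (Real.measurable_log.comp mabs)))).mul (mabs.pow_const _)
  have hΦ : Measurable (fun y => (v * (p1 * Pf α v y + q1 * Qf α v y)) *
      (v * (p2 * Pf α v y + q2 * Qf α v y)) / (gauss y - v * Rf α v y)) := by
    have := gauss_continuous
    exact Measurable.div (by fun_prop) (by fun_prop)
  have hΨ : Measurable (fun y => (v * Hm α p1 q1 y) * (v * Hm α p2 q2 y)
            / (gauss y + c * v * |y| ^ (-α-1))) := by
    refine Measurable.div ?_ (hgm.add (measurable_const.mul (mabs.pow_const _)))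
    exact (measurable_const.mul (mH _ _)).mul (measurable_const.mul (mH _ _))
  obtain ⟨iM, eM⟩ := tail_major hα0 hg0
  set X := g ^ (-(1/2):ℝ) with hX
  have hX0 : 0 < X := Real.rpow_pos_of_pos hg0 _
  have key : ∀ y, g < |y| →
      |(v * (p1 * Pf α v y + q1 * Qf α v y)) * (v * (p2 * Pf α v y + q2 * Qf α v y))
            / (gauss y - v * Rf α v y) - (v * Hm α p1 q1 y) * (v * Hm α p2 q2 y)
            / (gauss y + c * v * |y| ^ (-α-1))|
        ≤ (C3 * (m1 * m2) * (2 * X) * v) * (|y| ^ (-α-1) * (|y| / g) ^ (α/2)) ∧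
      |(v * Hm α p1 q1 y) * (v * Hm α p2 q2 y)
            / (gauss y + c * v * |y| ^ (-α-1))|
        ≤ (K3 ^ 2 / c * (m1 * m2) * v) * (|y| ^ (-α-1) * (|y| / g) ^ (α/2)) := by
    intro y hy
    have hy0 : 0 < |y| := hg0.trans hy
    have hy1 : 1 ≤ |y| := by linarith
    have hr : 1 ≤ |y| / g := by rw [le_div_iff₀ hg0]; linarith
    obtain ⟨bP, bQ, bR⟩ := hb2 y hy1
    have he : |y| ^ (-(1/2):ℝ) + v ≤ 2 * X := by
      have : |y| ^ (-(1/2):ℝ) ≤ X := Real.rpow_le_rpow_of_nonpos hg0 hy.le (by norm_num)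
      linarith
    have he0 : 0 ≤ |y| ^ (-(1/2):ℝ) + v := by positivity
    have hYp : 0 < |y| ^ (-α-1) := by positivity
    have hKe : 2 * K * (|y| ^ (-(1/2):ℝ) + v) ≤ c := by
      calc 2 * K * (|y| ^ (-(1/2):ℝ) + v) ≤ 2 * K * (2 * X) := by gcongr
        _ = 4 * K * X := by ring
        _ ≤ c := hv5
    have ht : 1 ≤ (|y| / g) ^ (α/4) := Real.one_le_rpow hr (by positivity)
    have ht2 : ((|y| / g) ^ (α/4)) ^ 2 = (|y| / g) ^ (α/2) := by
      rw [← Real.rpow_natCast, ← Real.rpow_mul (by positivity)]; congr 1; push_cast; ring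
    have := tail_pt (d := d) hc hYp hK0 he0 hKe hv0 (gauss_pos y).le hlg (by positivity : 0 ≤ 4 / α) ht
      (Real.log_nonneg hy1) (log_tail hα0 hg0 hy0) hp1 hq1 hp2 hq2 bP bQ bR hK3
    rw [ht2] at this
    refine ⟨this.1.trans ?_, this.2⟩
    rw [← hC3]
    gcongr
  have hg0' := gauss_pos g
  have hsc := split_compare (B := 8 * K ^ 2 * (m1 * m2) * (v ^ 2 / gauss g)) hg0 hΦ hΨ iM (by positivity)
    (fun y hy => inner_pt hK0 hv0 hg0' (gauss_anti hy) hv3 hp1 hq1' hp2 hq2'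
      (hb1 y).1 (hb1 y).2.1 (hb1 y).2.2) (fun y hy => (key y hy).1) (fun y hy => (key y hy).2)
  refine ⟨hsc.1, hsc.2.trans ?_⟩
  rw [eM]
  calc _ = 16 * K ^ 2 * (m1 * m2) * (v ^ 2 / gauss g * g)
          + C3 * 2 * (4 / α) * (m1 * m2) * (X * (v * g ^ (-α))) := by ring
    _ ≤ 16 * K ^ 2 * (m1 * m2) * (X * (v * g ^ (-α)))
          + C3 * 2 * (4 / α) * (m1 * m2) * (X * (v * g ^ (-α))) := by gcongr
    _ = _ := by ring


lemma Hm_P (α p y : ℝ) : Hm α p 0 y = -(p * cAlpha α) * |y| ^ (-α-1) := by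
  unfold Hm; ring

lemma Hm_L {α : ℝ} (hc : cAlpha α ≠ 0) (y : ℝ) :
    Hm α (-(deriv cAlpha α / cAlpha α)) 1 y = cAlpha α * (Real.log |y| * |y| ^ (-α-1)) := by
  unfold Hm; field_simp; ring

lemma integral_lin3 {f0 f1 f2 : ℝ → ℝ} {S : Set ℝ} (i0 : IntegrableOn f0 S) (i1 : IntegrableOn f1 S)
    (i2 : IntegrableOn f2 S) {a b c : ℝ} : ∫ y in S, (a * f0 y - b * f1 y + c * f2 y)
      = a * (∫ y in S, f0 y) - b * (∫ y in S, f1 y) + c * ∫ y in S, f2 y := by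
  have j0 : Integrable (fun y => a * f0 y) (volume.restrict S) := i0.const_mul a
  have j1 : Integrable (fun y => b * f1 y) (volume.restrict S) := i1.const_mul b
  have j2 : Integrable (fun y => c * f2 y) (volume.restrict S) := i2.const_mul c
  have j3 : Integrable (fun y => a * f0 y - b * f1 y) (volume.restrict S) := j0.sub j1
  rw [integral_add j3 j2, integral_sub j0 j1, integral_const_mul, integral_const_mul,
    integral_const_mul]

/-- integrability of the basic tail integrands -/
lemma tail_basic {α κ : ℝ} (hα : α ∈ Ioo (0:ℝ) 2) (hκ : 0 < κ) :
    ∃ C > 0, ∃ g0 : ℝ, 3 ≤ g0 ∧ ∀ g ≥ g0, ∀ v, v = κ * Real.exp (-(g^2)) → v ≤ 1 ∧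
      ∀ p1 q1 m1 p2 q2 m2 : ℝ, |p1| ≤ m1 → |q1| * (1 + Real.log g) ≤ m1 →
        |p2| ≤ m2 → |q2| * (1 + Real.log g) ≤ m2 →
        |(∫ y, (v * (p1 * Pf α v y + q1 * Qf α v y)) * (v * (p2 * Pf α v y + q2 * Qf α v y))
            / (gauss y - v * Rf α v y))
          - v ^ 2 * ((p1 * cAlpha α + q1 * deriv cAlpha α) * (p2 * cAlpha α + q2 * deriv cAlpha α)
              * (∫ y in {y : ℝ | g < |y|}, (|y| ^ (-α-1)) ^ 2
                / (gauss y + cAlpha α * v * |y| ^ (-α-1)))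
            - ((p1 * cAlpha α + q1 * deriv cAlpha α) * q2
                + q1 * (p2 * cAlpha α + q2 * deriv cAlpha α)) * cAlpha α
              * (∫ y in {y : ℝ | g < |y|}, (Real.log |y| * |y| ^ (-α-1)) * |y| ^ (-α-1)
                / (gauss y + cAlpha α * v * |y| ^ (-α-1)))
            + q1 * q2 * cAlpha α ^ 2
              * (∫ y in {y : ℝ | g < |y|}, (Real.log |y| * |y| ^ (-α-1)) ^ 2
                / (gauss y + cAlpha α * v * |y| ^ (-α-1))))|
          ≤ C * (m1 * m2) * (g ^ (-(1/2):ℝ) * (v * g ^ (-α))) := by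
  obtain ⟨C, hC, g0, hg0, h⟩ := main_lemma hα hκ
  refine ⟨C, hC, g0, hg0, fun g hg v hv => ?_⟩
  obtain ⟨hv1, h⟩ := h g hg v hv
  refine ⟨hv1, fun p1 q1 m1 p2 q2 m2 hp1 hq1 hp2 hq2 => ?_⟩
  have hc := cAlpha_pos hα
  have hv0 : 0 < v := by rw [hv]; positivity
  have i0 : IntegrableOn (fun y : ℝ => (|y| ^ (-α-1)) ^ 2
      / (gauss y + cAlpha α * v * |y| ^ (-α-1))) {y : ℝ | g < |y|} := by
    have := (h 1 0 1 1 0 1 (by simp) (by simp) (by simp) (by simp)).1.const_mul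
      (1 / (v * cAlpha α) ^ 2)
    simp only [Hm_P] at this
    refine this.congr (ae_of_all _ fun y => ?_)
    field_simp
  have hL : ∃ m, |-(deriv cAlpha α / cAlpha α)| ≤ m ∧ |(1:ℝ)| * (1 + Real.log g) ≤ m :=
    ⟨max _ _, le_max_left _ _, le_max_right _ _⟩
  obtain ⟨m, hm1, hm2⟩ := hL
  have i1 : IntegrableOn (fun y : ℝ => (Real.log |y| * |y| ^ (-α-1)) * |y| ^ (-α-1)
      / (gauss y + cAlpha α * v * |y| ^ (-α-1))) {y : ℝ | g < |y|} := by
    have := (h _ 1 m 1 0 1 hm1 hm2 (by simp) (by simp)).1.const_mul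
      (-1 / (v * cAlpha α) ^ 2)
    simp only [Hm_P, Hm_L hc.ne'] at this
    refine this.congr (ae_of_all _ fun y => ?_)
    field_simp
  have i2 : IntegrableOn (fun y : ℝ => (Real.log |y| * |y| ^ (-α-1)) ^ 2
      / (gauss y + cAlpha α * v * |y| ^ (-α-1))) {y : ℝ | g < |y|} := by
    have := (h _ 1 m _ 1 m hm1 hm2 hm1 hm2).1.const_mul
      (1 / (v * cAlpha α) ^ 2)
    simp only [Hm_L hc.ne'] at this
    refine this.congr (ae_of_all _ fun y => ?_)
    field_simp
  have hm := (h p1 q1 m1 p2 q2 m2 hp1 hq1 hp2 hq2).2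
  refine le_trans (le_of_eq ?_) hm
  congr 2
  have e : ∀ y : ℝ, (v * Hm α p1 q1 y) * (v * Hm α p2 q2 y)
            / (gauss y + cAlpha α * v * |y| ^ (-α-1))
      = v ^ 2 * ((p1 * cAlpha α + q1 * deriv cAlpha α) * (p2 * cAlpha α + q2 * deriv cAlpha α))
            * ((|y| ^ (-α-1)) ^ 2 / (gauss y + cAlpha α * v * |y| ^ (-α-1)))
        - v ^ 2 * (((p1 * cAlpha α + q1 * deriv cAlpha α) * q2
                + q1 * (p2 * cAlpha α + q2 * deriv cAlpha α)) * cAlpha α)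
            * ((Real.log |y| * |y| ^ (-α-1)) * |y| ^ (-α-1)
                / (gauss y + cAlpha α * v * |y| ^ (-α-1)))
        + v ^ 2 * (q1 * q2 * cAlpha α ^ 2) * ((Real.log |y| * |y| ^ (-α-1)) ^ 2
                / (gauss y + cAlpha α * v * |y| ^ (-α-1))) := by
    intro y; unfold Hm; ring
  simp_rw [e]
  rw [integral_lin3 i0 i1 i2]
  ring

lemma wn_facts {σ δ α : ℝ} (hσ : 0 < σ) (hδ : 0 < δ) (hα : α ∈ Ioo (0:ℝ) 2) {n : ℕ} (hn : 2 ≤ n) :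
    0 < wn n σ δ α ∧
    wn n σ δ α ^ α = (δ / σ) ^ α * Real.exp (-(Gamman n α ^ 2)) ∧
    wn n σ δ α ^ α = (δ / σ) ^ α * (1 / (n:ℝ) ^ (1 - α/2)) ∧
    wn n σ δ α ^ (2 * α) = (wn n σ δ α ^ α) ^ 2 ∧
    Real.log (wn n σ δ α) = (1/2 - 1/α) * Real.log n + Real.log (δ / σ) := by
  have hα0 := hα.1
  have hn0 : (0:ℝ) < n := by exact_mod_cast (by omega : 0 < n)
  have hn1 : (1:ℝ) ≤ n := by exact_mod_cast (by omega : 1 ≤ n)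
  have hl : 0 ≤ Real.log n := Real.log_nonneg hn1
  have hp : 0 < wn n σ δ α := by unfold wn; positivity
  have e : wn n σ δ α = (n:ℝ) ^ ((1:ℝ)/2 - 1/α) * (δ / σ) := by unfold wn; ring
  have hds : 0 < δ / σ := by positivity
  have h2 : wn n σ δ α ^ α = (δ / σ) ^ α * (1 / (n:ℝ) ^ (1 - α/2)) := by
    rw [e, Real.mul_rpow (by positivity) hds.le, ← Real.rpow_mul hn0.le, one_div ((n:ℝ) ^ _), ← Real.rpow_neg hn0.le,
      mul_comm]
    congr 2
    field_simp; ring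
  refine ⟨hp, ?_, h2, ?_, ?_⟩
  · rw [h2, Gamman, Real.sq_sqrt (mul_nonneg (by linarith [hα.2]) hl), one_div ((n:ℝ) ^ _), ← Real.rpow_neg hn0.le,
      Real.rpow_def_of_pos hn0]
    congr 2; ring
  · rw [← Real.rpow_natCast (_ ^ α) 2, ← Real.rpow_mul hp.le]; congr 1; push_cast; ring
  · rw [e, Real.log_mul (by positivity) hds.ne', Real.log_rpow hn0]

lemma n_eventually (α g0 : ℝ) (hα : α ∈ Ioo (0:ℝ) 2) : ∃ N : ℕ, ∀ n ≥ N,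
    2 ≤ n ∧ 1 ≤ Real.log (Real.log n) ∧ 0 < Real.log n ∧ g0 ≤ Gamman n α := by
  have hl : Tendsto (fun n : ℕ => Real.log n) atTop atTop :=
    Real.tendsto_log_atTop.comp tendsto_natCast_atTop_atTop
  have hr : 0 < 1 - α/2 := by linarith [hα.2]
  have hg : Tendsto (fun n : ℕ => Gamman n α) atTop atTop :=
    Real.tendsto_sqrt_atTop.comp (hl.const_mul_atTop hr)
  have := ((eventually_ge_atTop 2).and (((Real.tendsto_log_atTop.comp hl).eventually_ge_atTop 1).and
    ((hl.eventually_gt_atTop 0).and (hg.eventually_ge_atTop g0))))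
  exact eventually_atTop.1 this

lemma err_eq {α κ l v nn : ℝ} (hα : α ∈ Ioo (0:ℝ) 2) (hl : 0 < l) (hv : v = κ * (1 / nn)) :
    (Real.sqrt ((1 - α/2) * l)) ^ (-(1/2):ℝ) * (v * (Real.sqrt ((1 - α/2) * l)) ^ (-α))
      = (κ * ((1 - α/2) ^ (-(1/4):ℝ) * (1 - α/2) ^ (-(α/2)))) * (1 / l ^ ((1:ℝ)/4)) *
        (1 / (nn * l ^ (α/2))) := by
  have hr : 0 < 1 - α/2 := by linarith [hα.2]
  have hp : 0 ≤ (1 - α/2) * l := by positivity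
  rw [Real.sqrt_eq_rpow, ← Real.rpow_mul hp, ← Real.rpow_mul hp, Real.mul_rpow hr.le hl.le,
    Real.mul_rpow hr.le hl.le, hv, show (1:ℝ)/2 * -(1/2) = -(1/4) by norm_num,
    show (1:ℝ)/2 * -α = -(α/2) by ring, Real.rpow_neg hl.le, Real.rpow_neg hl.le]
  simp only [one_div, mul_inv]
  ring

/-- reduction of the integrals `∫ h²/f`, `∫ h l/f`, `∫ l²/f` to explicit
integrals over `{|y| > Γ_n}`. -/
theorem statement17 (σ δ α : ℝ) (hσ : 0 < σ) (hδ : 0 < δ) (hα : α ∈ Set.Ioo (0 : ℝ) 2)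
    (ψ : ℝ → ℕ → ℝ → ℝ) (hψ : IsPsiFamily ψ) :
    ∃ C > (0 : ℝ), ∃ N : ℕ, ∀ n ≥ N,
      |(∫ y : ℝ, hFun α y (wn n σ δ α) ^ 2 / fFun α y (wn n σ δ α))
          - wn n σ δ α ^ (2 * α) * α ^ 2 * cAlpha α ^ 2 *
            ∫ y in {y : ℝ | Gamman n α < |y|},
              ψ α 0 y ^ 2 / (gauss y + cAlpha α * wn n σ δ α ^ α * ψ α 0 y)| ≤
        C * (1 / Real.log n ^ ((1 : ℝ) / 4)) *
          (1 / ((n : ℝ) ^ (1 - α / 2) * Real.log n ^ (α / 2))) ∧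
      |(∫ y : ℝ, hFun α y (wn n σ δ α) * lFun n α y (wn n σ δ α) / fFun α y (wn n σ δ α))
          - wn n σ δ α ^ (2 * α) *
            (α * cAlpha α ^ 2 *
              (∫ y in {y : ℝ | Gamman n α < |y|},
                ψ α 1 y * ψ α 0 y / (gauss y + cAlpha α * wn n σ δ α ^ α * ψ α 0 y))
              - α * cAlpha α * (cAlpha α / 2 * Real.log (Real.log n) + Kconst σ δ α) *
                ∫ y in {y : ℝ | Gamman n α < |y|},
                  ψ α 0 y ^ 2 / (gauss y + cAlpha α * wn n σ δ α ^ α * ψ α 0 y))| ≤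
        C * (Real.log (Real.log n) / Real.log n ^ ((1 : ℝ) / 4)) *
          (1 / ((n : ℝ) ^ (1 - α / 2) * Real.log n ^ (α / 2))) ∧
      |(∫ y : ℝ, lFun n α y (wn n σ δ α) ^ 2 / fFun α y (wn n σ δ α))
          - wn n σ δ α ^ (2 * α) *
            (cAlpha α ^ 2 *
              (∫ y in {y : ℝ | Gamman n α < |y|},
                ψ α 1 y ^ 2 / (gauss y + cAlpha α * wn n σ δ α ^ α * ψ α 0 y))
              - 2 * cAlpha α * (cAlpha α / 2 * Real.log (Real.log n) + Kconst σ δ α) *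
                (∫ y in {y : ℝ | Gamman n α < |y|},
                  ψ α 1 y * ψ α 0 y / (gauss y + cAlpha α * wn n σ δ α ^ α * ψ α 0 y))
              + (cAlpha α / 2 * Real.log (Real.log n) + Kconst σ δ α) ^ 2 *
                ∫ y in {y : ℝ | Gamman n α < |y|},
                  ψ α 0 y ^ 2 / (gauss y + cAlpha α * wn n σ δ α ^ α * ψ α 0 y))| ≤
        C * (Real.log (Real.log n) ^ 2 / Real.log n ^ ((1 : ℝ) / 4)) *
          (1 / ((n : ℝ) ^ (1 - α / 2) * Real.log n ^ (α / 2))) := by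
  obtain ⟨C, hC, g0, hg0, hmain⟩ := tail_basic (κ := (δ / σ) ^ α) hα (by positivity)
  obtain ⟨N, hN⟩ := n_eventually α g0 hα
  have hr : 0 < 1 - α/2 := by linarith [hα.2]
  set ρ := (δ / σ) ^ α * ((1 - α/2) ^ (-(1/4):ℝ) * (1 - α/2) ^ (-(α/2))) with hρ
  have hρ0 : 0 < ρ := by positivity
  set C0 := 2 + |Real.log (δ / σ)| with hC0
  have hC00 : 0 < C0 := by positivity
  refine ⟨C * ρ * (4 + 2 * C0 + C0 ^ 2), by positivity, N, fun n hn => ?_⟩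
  obtain ⟨hn2, hlam, hl, hgn⟩ := hN n hn
  obtain ⟨hw, hw1, hw2, hw3, hw4⟩ := wn_facts hσ hδ hα hn2
  have hg3 : 3 ≤ Gamman n α := hg0.trans hgn
  obtain ⟨hv1, hm⟩ := hmain _ hgn _ hw1
  have herr := err_eq hα hl hw2
  rw [← hρ] at herr
  change Gamman n α ^ _ * (_ * Gamman n α ^ _) = _ at herr
  rw [herr] at hm
  set w := wn n σ δ α with hwdef
  set v := w ^ α with hv
  set lam := Real.log (Real.log n) with hlamdef
  set g := Gamman n α with hgdef
  set c := cAlpha α with hc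
  set d := deriv cAlpha α with hd
  set b := lam / 2 + Real.log (δ / σ) with hb
  have hB : c / 2 * lam + Kconst σ δ α = c * b + d := by
    rw [Kconst, hb]; ring
  rw [hB, hw3]
  have eh : ∀ y, hFun α y w = v * (α * Pf α v y + 0 * Qf α v y) := by
    intro y; rw [hFun_eq hα.1 y hw]; ring
  have ef : ∀ y, fFun α y w = gauss y - v * Rf α v y := fun y => fFun_eq hα.1 y hw hv1
  have el : ∀ y, lFun n α y w = v * ((-b) * Pf α v y + (-1) * Qf α v y) := by
    intro y
    have hα0 := hα.1.ne'
    rw [lFun, kFun_eq hα.1 y hw hv1, hFun_eq hα.1 y hw, hw4, ← hlamdef, ← hv, hb]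
    field_simp
    ring
  have hS : MeasurableSet {y : ℝ | g < |y|} := by
    rw [tail_set g (by linarith)]; exact measurableSet_Ioi.union measurableSet_Iio
  have ψ0 : ∀ y, g < |y| → ψ α 0 y = |y| ^ (-α-1) := by
    intro y hy
    rw [hψ.eq_tail α hα 0 y (by linarith), pow_zero, show -α - 1 = -(α + 1) by ring,
      Real.rpow_neg (abs_nonneg y), one_div]
  have ψ1 : ∀ y, g < |y| → ψ α 1 y = Real.log |y| * |y| ^ (-α-1) := by
    intro y hy
    rw [hψ.eq_tail α hα 1 y (by linarith), pow_one, show -α - 1 = -(α + 1) by ring,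
      Real.rpow_neg (abs_nonneg y), div_eq_mul_inv]
  have I0 : ∫ y in {y : ℝ | g < |y|}, ψ α 0 y ^ 2 / (gauss y + c * v * ψ α 0 y)
      = ∫ y in {y : ℝ | g < |y|}, (|y| ^ (-α-1)) ^ 2 / (gauss y + c * v * |y| ^ (-α-1)) :=
    setIntegral_congr_fun hS fun y hy => by
      rw [ψ0 y hy]
  have I1 : ∫ y in {y : ℝ | g < |y|}, ψ α 1 y * ψ α 0 y / (gauss y + c * v * ψ α 0 y)
      = ∫ y in {y : ℝ | g < |y|}, (Real.log |y| * |y| ^ (-α-1)) * |y| ^ (-α-1)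
          / (gauss y + c * v * |y| ^ (-α-1)) :=
    setIntegral_congr_fun hS fun y hy => by
      rw [ψ0 y hy, ψ1 y hy]
  have I2 : ∫ y in {y : ℝ | g < |y|}, ψ α 1 y ^ 2 / (gauss y + c * v * ψ α 0 y)
      = ∫ y in {y : ℝ | g < |y|}, (Real.log |y| * |y| ^ (-α-1)) ^ 2
          / (gauss y + c * v * |y| ^ (-α-1)) :=
    setIntegral_congr_fun hS fun y hy => by
      rw [ψ0 y hy, ψ1 y hy]
  rw [I0, I1, I2]
  have eh2 : ∀ y, hFun α y w ^ 2 = (v * (α * Pf α v y + 0 * Qf α v y))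
      * (v * (α * Pf α v y + 0 * Qf α v y)) := fun y => by rw [eh, sq]
  have el2 : ∀ y, lFun n α y w ^ 2 = (v * ((-b) * Pf α v y + (-1) * Qf α v y))
      * (v * ((-b) * Pf α v y + (-1) * Qf α v y)) := fun y => by rw [el, sq]
  simp only [eh2, el2]
  simp only [eh, el, ef]
  set J0 := ∫ y in {y : ℝ | g < |y|}, (|y| ^ (-α-1)) ^ 2 / (gauss y + c * v * |y| ^ (-α-1))
  set J1 := ∫ y in {y : ℝ | g < |y|}, (Real.log |y| * |y| ^ (-α-1)) * |y| ^ (-α-1)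
          / (gauss y + c * v * |y| ^ (-α-1))
  set J2 := ∫ y in {y : ℝ | g < |y|}, (Real.log |y| * |y| ^ (-α-1)) ^ 2
          / (gauss y + c * v * |y| ^ (-α-1))
  have hlg0 : 0 ≤ Real.log g := Real.log_nonneg (by linarith)
  have hlg : Real.log g ≤ lam / 2 := by
    rw [hgdef, Gamman, Real.log_sqrt (by positivity), Real.log_mul hr.ne' hl.ne']
    have : Real.log (1 - α/2) ≤ 0 := Real.log_nonpos hr.le (by linarith [hα.1])
    linarith
  have hp1 : |α| ≤ 2 := by rw [abs_of_pos hα.1]; exact hα.2.le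
  have hq1 : |(0:ℝ)| * (1 + Real.log g) ≤ 2 := by simp
  have hds0 := abs_nonneg (Real.log (δ / σ))
  have hp2 : |-b| ≤ C0 * lam := by
    rw [abs_neg, hb]
    refine (abs_add_le _ _).trans ?_
    rw [abs_of_nonneg (by linarith), hC0]
    have h5 := mul_le_mul_of_nonneg_left hlam hds0
    linarith
  have hq2 : |(-1:ℝ)| * (1 + Real.log g) ≤ C0 * lam := by
    rw [abs_neg, abs_one, one_mul, hC0]
    have h5 := mul_le_mul_of_nonneg_left hlam hds0
    linarith
  set T := 1 / ((n:ℝ) ^ (1 - α / 2) * Real.log n ^ (α / 2)) with hT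
  have hT0 : 0 ≤ T := by positivity
  set U := Real.log n ^ ((1:ℝ) / 4) with hU
  have hU0 : 0 < U := by positivity
  have hCC : ∀ k, 0 ≤ k → k ≤ 4 + 2 * C0 + C0 ^ 2 → ∀ z, 0 ≤ z →
      C * ρ * k * z ≤ C * ρ * (4 + 2 * C0 + C0 ^ 2) * z := by
    intro k hk0 hk z hz
    gcongr
  have hl0 : 0 ≤ lam := by linarith
  refine ⟨?_, ?_, ?_⟩
  · have h1 := hm α 0 2 α 0 2 hp1 hq1 hp1 hq1
    have e : v ^ 2 * α ^ 2 * c ^ 2 * J0 = v ^ 2 * ((α * c + 0 * d) * (α * c + 0 * d) * J0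
        - ((α * c + 0 * d) * 0 + 0 * (α * c + 0 * d)) * c * J1 + 0 * 0 * c ^ 2 * J2) := by ring
    rw [e]
    refine h1.trans ?_
    calc _ = C * ρ * 4 * (1 / U * T) := by ring
      _ ≤ C * ρ * (4 + 2 * C0 + C0 ^ 2) * (1 / U * T) :=
        hCC 4 (by norm_num) (by linarith [sq_nonneg C0]) _ (by positivity)
      _ = _ := by ring
  · have h1 := hm α 0 2 (-b) (-1) (C0 * lam) hp1 hq1 hp2 hq2
    have e : v ^ 2 * (α * c ^ 2 * J1 - α * c * (c * b + d) * J0)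
        = v ^ 2 * ((α * c + 0 * d) * (-b * c + -1 * d) * J0
        - ((α * c + 0 * d) * -1 + 0 * (-b * c + -1 * d)) * c * J1 + 0 * -1 * c ^ 2 * J2) := by ring
    rw [e]
    refine h1.trans ?_
    calc _ = C * ρ * (2 * C0) * (lam / U * T) := by ring
      _ ≤ C * ρ * (4 + 2 * C0 + C0 ^ 2) * (lam / U * T) :=
        hCC (2 * C0) (by positivity) (by linarith [sq_nonneg C0]) _ (by positivity)
      _ = _ := by ring
  · have h1 := hm (-b) (-1) (C0 * lam) (-b) (-1) (C0 * lam) hp2 hq2 hp2 hq2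
    have e : v ^ 2 * (c ^ 2 * J2 - 2 * c * (c * b + d) * J1 + (c * b + d) ^ 2 * J0)
        = v ^ 2 * ((-b * c + -1 * d) * (-b * c + -1 * d) * J0
        - ((-b * c + -1 * d) * -1 + -1 * (-b * c + -1 * d)) * c * J1 + -1 * -1 * c ^ 2 * J2) := by
      ring
    rw [e]
    refine h1.trans ?_
    calc _ = C * ρ * C0 ^ 2 * (lam ^ 2 / U * T) := by ring
      _ ≤ C * ρ * (4 + 2 * C0 + C0 ^ 2) * (lam ^ 2 / U * T) :=
        hCC (C0 ^ 2) (by positivity) (by linarith [sq_nonneg C0]) _ (by positivity)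
      _ = _ := by ring

end LevyLAN
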